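/- arXiv:1111.0217 — 2 statements merged into one kernel-verified Lean document; each statement's English description precedes it below -/
import Mathlib

section
/- Solynin's extremal estimate (lower bound): Let 0 < λ < 1 and let K be a closed subset of the real interval [−1, 1] with one-dimensional Lebesgue measure |K| = 2λ and with 0 ∉ K. Let 𝔻 denote the open unit disk in ℂ and let ω be a harmonic measure function of K with respect to 𝔻. Then ω(0) ≥ (2/π) · arcsin( (1 − (1−λ)²) / (1 + (1−λ)²) ). -/
open Complex MeasureTheory Metric Filter Set

/-- The planar Laplacian of a function `u : ℂ → ℝ`:
`Δu = ∂²u/∂x² + ∂²u/∂y²` expressed via iterated real Fréchet derivatives. -/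
noncomputable def planarLaplacian (u : ℂ → ℝ) (z : ℂ) : ℝ :=
  fderiv ℝ (fun w => fderiv ℝ u w 1) z 1 +
  fderiv ℝ (fun w => fderiv ℝ u w Complex.I) z Complex.I

/-- `u` is harmonic on the open set `U`: twice continuously differentiable
(in the real sense) and satisfying Laplace's equation on `U`. -/
def HarmonicOnSet (u : ℂ → ℝ) (U : Set ℂ) : Prop :=
  ContDiffOn ℝ 2 u U ∧ ∀ z ∈ U, planarLaplacian u z = 0

/-- `ω` is a harmonic measure function of the closed set `K` with respect to
the bounded open set `Ω`: harmonic on `Ω \ K`, with values in `[0,1]` there,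
boundary values `1` on `K ∩ Ω` and `0` on `∂Ω \ K`. -/
def IsHarmonicMeasureFn (ω : ℂ → ℝ) (Ω K : Set ℂ) : Prop :=
  HarmonicOnSet ω (Ω \ K) ∧
  (∀ z ∈ Ω \ K, 0 ≤ ω z ∧ ω z ≤ 1) ∧
  (∀ ζ ∈ K ∩ Ω, Filter.Tendsto ω (nhdsWithin ζ (Ω \ K)) (nhds 1)) ∧
  (∀ ζ ∈ frontier Ω \ K, Filter.Tendsto ω (nhdsWithin ζ (Ω \ K)) (nhds 0))

/-- The kernel whose integral over `K` is the logarithm of the gradient of the test function. -/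
noncomputable def slitKernel (z : ℂ) (t : ℝ) : ℂ :=
  (1 - (t : ℂ) ^ 2) * z / (((|t| : ℝ) : ℂ) * ((z - t) * (1 - t * z)))

/-- The integrated kernel. -/
noncomputable def slitLog (K : Set ℝ) (z : ℂ) : ℂ := ∫ t in K, slitKernel z t

/-- Exponential of the integrated kernel. -/
noncomputable def slitFun (K : Set ℝ) (z : ℂ) : ℂ := Complex.exp (-(slitLog K z) / 2)

theorem differentiableAt_slitLog {K : Set ℝ} (hK : IsCompact K) (h0 : (0 : ℝ) ∉ K) {z₀ : ℂ}
    (hz : ∀ t ∈ K, (z₀ - t) * (1 - t * z₀) ≠ 0) :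
    DifferentiableAt ℂ (slitLog K) z₀ := by
  have hcD : Continuous fun p : ℂ × ℝ => (p.1 - p.2) * (1 - (p.2 : ℂ) * p.1) := by fun_prop
  -- a neighbourhood on which the denominator does not vanish
  obtain ⟨ε, hε, hball⟩ : ∃ ε > 0, ∀ z ∈ closedBall z₀ ε, ∀ t ∈ K,
      (z - (t : ℂ)) * (1 - (t : ℂ) * z) ≠ 0 := by
    have : ∀ᶠ z : ℂ in nhds z₀, ∀ t ∈ K, (z - (t : ℂ)) * (1 - (t : ℂ) * z) ≠ 0 := by
      apply hK.eventually_forall_of_forall_eventually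
      intro t ht
      have := hcD.continuousAt (x := (z₀, t))
      exact this.eventually_ne (hz t ht)
    obtain ⟨ε, hε, h⟩ := Metric.eventually_nhds_iff_ball.1 this
    exact ⟨ε / 2, by positivity, fun z hz t ht =>
      h z (by rw [mem_closedBall] at hz; rw [mem_ball]; linarith) t ht⟩
  have ht0 : ∀ t ∈ K, ((|t| : ℝ) : ℂ) ≠ 0 := by
    intro t ht h
    apply h0
    have : t = 0 := by simpa using h
    rwa [← this]
  let F' : ℂ → ℝ → ℂ := fun z t => (1 - (t : ℂ) ^ 2) / ((|t| : ℝ) : ℂ) *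
    (((z - t) * (1 - t * z) - z * ((1 - t * z) - t * (z - t))) / ((z - t) * (1 - t * z)) ^ 2)
  have hF'c : ContinuousOn (Function.uncurry F') (closedBall z₀ ε ×ˢ K) := by
    intro p hp
    apply ContinuousAt.continuousWithinAt
    have h1 := ht0 p.2 hp.2
    have h2 := pow_ne_zero 2 (hball p.1 hp.1 p.2 hp.2)
    simp only [Function.uncurry_def, F']
    apply ContinuousAt.mul
    · exact ContinuousAt.div (by fun_prop) (by fun_prop) h1
    · exact ContinuousAt.div (by fun_prop) (by fun_prop) h2
  have hFc : ContinuousOn (Function.uncurry slitKernel) (closedBall z₀ ε ×ˢ K) := by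
    intro p hp
    apply ContinuousAt.continuousWithinAt
    have h1 := ht0 p.2 hp.2
    have h2 := (hball p.1 hp.1 p.2 hp.2)
    simp only [Function.uncurry_def, slitKernel]
    exact ContinuousAt.div (by fun_prop) (by fun_prop) (mul_ne_zero h1 h2)
  have hsec : ∀ {G : ℂ → ℝ → ℂ}, ContinuousOn (Function.uncurry G) (closedBall z₀ ε ×ˢ K) →
      ∀ z ∈ closedBall z₀ ε, ContinuousOn (G z) K := by
    intro G hG z hz
    exact hG.comp (f := fun t => (z, t)) (by fun_prop) (fun t ht => ⟨hz, ht⟩)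
  obtain ⟨M, hM⟩ := ((isCompact_closedBall z₀ ε).prod hK).exists_bound_of_continuousOn hF'c
  have hz₀ : z₀ ∈ closedBall z₀ ε := mem_closedBall_self hε.le
  refine (hasDerivAt_integral_of_dominated_loc_of_deriv_le (μ := volume.restrict K)
    (F := slitKernel) (F' := F') (bound := fun _ => M) (ball_mem_nhds z₀ hε) ?_ ?_ ?_ ?_ ?_ ?_
    ).2.differentiableAt
  · filter_upwards [ball_mem_nhds z₀ hε] with z hz
    exact (hsec hFc z (ball_subset_closedBall hz)).aestronglyMeasurable hK.measurableSet
  · exact (hsec hFc z₀ hz₀).integrableOn_compact hK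
  · exact (hsec hF'c z₀ hz₀).aestronglyMeasurable hK.measurableSet
  · filter_upwards [ae_restrict_mem hK.measurableSet] with t ht z hz
    exact hM (z, t) ⟨ball_subset_closedBall hz, ht⟩
  · exact integrableOn_const hK.measure_lt_top.ne
  · filter_upwards [ae_restrict_mem hK.measurableSet] with t ht z hz
    have h1 := ht0 t ht
    have h2 := hball z (ball_subset_closedBall hz) t ht
    have hd : HasDerivAt (fun z : ℂ => (z - t) * (1 - t * z))
        (1 * (1 - t * z) + (z - t) * (0 - t * 1)) z :=
      ((hasDerivAt_id z).sub_const _).mul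
        ((hasDerivAt_const z (1 : ℂ)).sub ((hasDerivAt_id z).const_mul (t : ℂ)))
    have := ((hasDerivAt_id z).div hd h2).const_mul ((1 - (t : ℂ) ^ 2) / ((|t| : ℝ) : ℂ))
    have hfun : (fun w => slitKernel w t) = fun y => (1 - (t : ℂ) ^ 2) / ((|t| : ℝ) : ℂ) *
        ((id : ℂ → ℂ) / fun z : ℂ => (z - t) * (1 - t * z)) y := by
      ext w
      simp only [slitKernel, id, Pi.div_apply]
      rw [div_mul_div_comm]
    rw [hfun]
    refine this.congr_deriv ?_
    simp only [F', id]
    ring_nf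

theorem differentiableAt_slitFun {K : Set ℝ} (hK : IsCompact K) (h0 : (0 : ℝ) ∉ K) {z₀ : ℂ}
    (hz : ∀ t ∈ K, (z₀ - t) * (1 - t * z₀) ≠ 0) :
    DifferentiableAt ℂ (slitFun K) z₀ :=
  ((differentiableAt_slitLog hK h0 hz).neg.div_const 2).cexp

theorem slitFun_zero (K : Set ℝ) : slitFun K 0 = 1 := by
  simp [slitFun, slitLog, slitKernel]

theorem slitFun_ofReal_im (K : Set ℝ) (x : ℝ) : (slitFun K x).im = 0 := by
  have : slitLog K x = ((∫ t in K, (1 - t ^ 2) * x / (|t| * ((x - t) * (1 - t * x))) : ℝ) : ℂ) := by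
    rw [slitLog, ← integral_complex_ofReal]
    congr 1
    ext t
    simp [slitKernel]
  rw [slitFun, this]
  rw [show (-((∫ t in K, (1 - t ^ 2) * x / (|t| * ((x - t) * (1 - t * x))) : ℝ) : ℂ) / 2) =
    ((-(∫ t in K, (1 - t ^ 2) * x / (|t| * ((x - t) * (1 - t * x))))/2 : ℝ) : ℂ) by push_cast; ring]
  exact Complex.exp_ofReal_im _

/-- The Poisson-type kernel on the unit circle in the variable `c = cos τ`. -/
noncomputable def poissonCos (t c : ℝ) : ℝ := (1 - t ^ 2) / (|t| * (1 + t ^ 2 - 2 * t * c))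

theorem slitKernel_circle (t : ℝ) (z : ℂ) (hz : ‖z‖ = 1) :
    slitKernel z t = (poissonCos t z.re : ℝ) := by
  have hz0 : z ≠ 0 := by intro h; simp [h] at hz
  have hzz : z * (starRingEnd ℂ) z = 1 := by
    rw [Complex.mul_conj, Complex.normSq_eq_norm_sq, hz]; simp
  have hre : (z.re : ℂ) = (z + (starRingEnd ℂ) z) / 2 := by
    rw [Complex.add_conj]; push_cast; ring
  have : (z - t) * (1 - t * z) = z * (1 + t ^ 2 - 2 * t * (z.re : ℂ)) := by
    rw [hre]
    linear_combination (t : ℂ) * hzz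
  rw [slitKernel, poissonCos, this]
  push_cast
  rw [show (((|t| : ℝ) : ℂ) * (z * (1 + t ^ 2 - 2 * t * (z.re : ℂ)))) = z *
    (((|t| : ℝ) : ℂ) * ((1 + t ^ 2 - 2 * t * (z.re : ℂ)))) by ring, mul_comm _ z,
    mul_div_mul_left _ _ hz0]

theorem slitFun_circle (K : Set ℝ) (z : ℂ) (hz : ‖z‖ = 1) :
    slitFun K z = (Real.exp (-(∫ t in K, poissonCos t z.re) / 2) : ℝ) := by
  rw [slitFun, slitLog, integral_congr_ae (g := fun t => ((poissonCos t z.re : ℝ) : ℂ))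
    (ae_of_all _ fun t => slitKernel_circle t z hz), integral_complex_ofReal]
  push_cast
  rfl

theorem slit_denominator_ne_zero {z : ℂ} (hz : z.im ≠ 0) (t : ℝ) :
    (z - (t : ℂ)) * (1 - (t : ℂ) * z) ≠ 0 := by
  refine mul_ne_zero ?_ ?_
  · intro h
    apply hz
    have := congrArg Complex.im h
    simpa using this
  · intro h
    by_cases ht : t = 0
    · simp [ht] at h
    · have := congrArg Complex.im h
      simp [ht, hz] at this

theorem continuousOn_slitKernel {z : ℂ} (hz : z.im ≠ 0) {s : Set ℝ} (hs : ∀ t ∈ s, t ≠ 0) :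
    ContinuousOn (slitKernel z) s := by
  intro t ht
  apply ContinuousAt.continuousWithinAt
  unfold slitKernel
  refine ContinuousAt.div (by fun_prop) (by fun_prop) (mul_ne_zero ?_ ?_)
  · simpa using hs t ht
  · exact slit_denominator_ne_zero hz t

theorem slit_joukowski_im_pos {z : ℂ} (hz : 0 < z.im) (hz1 : ‖z‖ < 1) (t : ℝ) :
    0 < ((((t + 1 / t : ℝ)) : ℂ) - (z + 1 / z)).im := by
  have h0 : z ≠ 0 := by rintro rfl; simp at hz
  have hn : Complex.normSq z < 1 := by
    rw [Complex.normSq_eq_norm_sq]; nlinarith [norm_nonneg z]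
  have hp : 0 < Complex.normSq z := Complex.normSq_pos.2 h0
  have : ((((t + 1 / t : ℝ)) : ℂ) - (z + 1 / z)).im = z.im / Complex.normSq z - z.im := by
    rw [Complex.sub_im, Complex.ofReal_im, Complex.add_im, one_div, Complex.inv_im]; ring
  rw [this, sub_pos, lt_div_iff₀ hp]
  nlinarith

theorem hasDerivAt_log_slit {z : ℂ} (hz : 0 < z.im) (hz1 : ‖z‖ < 1) {t : ℝ} (ht : t ≠ 0) :
    HasDerivAt (fun s : ℝ => Complex.log ((((s + 1 / s : ℝ)) : ℂ) - (z + 1 / z)))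
      (-((1 - (t : ℂ) ^ 2) * z / ((t : ℂ) * ((z - t) * (1 - t * z))))) t := by
  have h0 : z ≠ 0 := by rintro rfl; simp at hz
  have ht' : (t : ℂ) ≠ 0 := by exact_mod_cast ht
  have h1 : HasDerivAt (fun s : ℝ => (s + 1 / s : ℝ)) (1 - 1 / t ^ 2) t := by
    simpa only [one_div, sub_eq_add_neg] using (hasDerivAt_id' t).fun_add (hasDerivAt_inv ht)
  have h2 := (h1.ofReal_comp).sub_const (z + 1 / z)
  have him := slit_joukowski_im_pos hz hz1 t
  have h3 := h2.clog_real (Or.inr him.ne')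
  convert h3 using 1
  have hd := slit_denominator_ne_zero hz.ne' t
  have hne : (((t + 1 / t : ℝ) : ℂ) - (z + 1 / z)) ≠ 0 := by
    intro h; rw [h] at him; simp at him
  have e : (((t + 1 / t : ℝ) : ℂ) - (z + 1 / z)) = (z - t) * (1 - t * z) / (t * z) := by
    push_cast; field_simp; ring
  rw [e]
  push_cast
  have := (mul_ne_zero_iff.1 hd).1
  have := (mul_ne_zero_iff.1 hd).2
  field_simp
  ring

theorem abs_im_log_sub_log_le {v w : ℂ} (hv : 0 < v.im) (hw : 0 < w.im) :
    |(Complex.log v - Complex.log w).im| ≤ Real.pi := by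
  rw [Complex.sub_im, Complex.log_im, Complex.log_im]
  have a1 : 0 ≤ v.arg := Complex.arg_nonneg_iff.2 hv.le
  have a2 : 0 ≤ w.arg := Complex.arg_nonneg_iff.2 hw.le
  have b1 := Complex.arg_le_pi v
  have b2 := Complex.arg_le_pi w
  rw [abs_le]; constructor <;> linarith

theorem slitKernel_eq {z : ℂ} (hz : 0 < z.im) (hz1 : ‖z‖ < 1) {t : ℝ} (ht : t ≠ 0) :
    slitKernel z t = ((1 / t ^ 2 - 1 : ℝ) : ℂ) * (((t / |t| : ℝ) : ℂ)) *
      (1 / ((((t + 1 / t : ℝ)) : ℂ) - (z + 1 / z))) := by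
  have h0 : z ≠ 0 := by rintro rfl; simp at hz
  have ht' : (t : ℂ) ≠ 0 := by exact_mod_cast ht
  have hta : ((|t| : ℝ) : ℂ) ≠ 0 := by exact_mod_cast abs_ne_zero.2 ht
  have hd := slit_denominator_ne_zero hz.ne' t
  have e : (((t + 1 / t : ℝ) : ℂ) - (z + 1 / z)) = (z - t) * (1 - t * z) / (t * z) := by
    push_cast; field_simp; ring
  rw [e, slitKernel]
  push_cast
  have := (mul_ne_zero_iff.1 hd).1
  have := (mul_ne_zero_iff.1 hd).2
  field_simp

theorem slitKernel_im_nonpos {z : ℂ} (hz : 0 < z.im) (hz1 : ‖z‖ < 1) {t : ℝ} (ht : 0 < t)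
    (ht1 : t ≤ 1) : (slitKernel z t).im ≤ 0 := by
  rw [slitKernel_eq hz hz1 ht.ne', abs_of_pos ht, div_self ht.ne']
  rw [Complex.ofReal_one, mul_one, Complex.im_ofReal_mul, one_div (_ - _), Complex.inv_im]
  have him := slit_joukowski_im_pos hz hz1 t
  refine mul_nonpos_of_nonneg_of_nonpos ?_ (div_nonpos_of_nonpos_of_nonneg (by linarith)
    (Complex.normSq_nonneg _))
  rw [sub_nonneg, le_div_iff₀ (by positivity)]
  nlinarith

theorem slitKernel_im_nonneg {z : ℂ} (hz : 0 < z.im) (hz1 : ‖z‖ < 1) {t : ℝ} (ht : t < 0)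
    (ht1 : -1 ≤ t) : 0 ≤ (slitKernel z t).im := by
  rw [slitKernel_eq hz hz1 ht.ne, abs_of_neg ht, div_neg, div_self ht.ne]
  rw [mul_assoc, Complex.im_ofReal_mul, Complex.im_ofReal_mul, one_div (_ - _), Complex.inv_im]
  have him := slit_joukowski_im_pos hz hz1 t
  refine mul_nonneg ?_ (mul_nonneg_of_nonpos_of_nonpos (by norm_num)
    (div_nonpos_of_nonpos_of_nonneg (by linarith) (Complex.normSq_nonneg _)))
  rw [sub_nonneg, le_div_iff₀ (by nlinarith)]
  nlinarith

theorem setIntegral_im {f : ℝ → ℂ} {s : Set ℝ} (hf : IntegrableOn f s) :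
    (∫ t in s, f t).im = ∫ t in s, (f t).im :=
  (integral_im (𝕜 := ℂ) hf).symm

theorem abs_integral_slitKernel_le {z : ℂ} (hz : 0 < z.im) (hz1 : ‖z‖ < 1) {a b : ℝ}
    (hab : a ≤ b) (h : 0 < a ∨ b < 0) :
    |(∫ t in a..b, slitKernel z t).im| ≤ Real.pi := by
  have hne : ∀ t ∈ Set.uIcc a b, t ≠ 0 := by
    intro t ht
    rw [Set.uIcc_of_le hab] at ht
    rcases h with h | h
    · exact (h.trans_le ht.1).ne'
    · exact (ht.2.trans_lt h).ne
  have hint : IntervalIntegrable (slitKernel z) volume a b :=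
    (continuousOn_slitKernel hz.ne' hne).intervalIntegrable
  rcases h with h | h
  · rw [intervalIntegral.integral_eq_sub_of_hasDerivAt
      (f := fun s : ℝ => -Complex.log ((((s + 1 / s : ℝ)) : ℂ) - (z + 1 / z))) ?_ hint]
    · rw [neg_sub_neg]
      exact abs_im_log_sub_log_le (slit_joukowski_im_pos hz hz1 _) (slit_joukowski_im_pos hz hz1 _)
    · intro t ht
      refine (hasDerivAt_log_slit hz hz1 (hne t ht)).neg.congr_deriv ?_
      have : 0 < t := by rw [Set.uIcc_of_le hab] at ht; exact h.trans_le ht.1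
      rw [neg_neg, slitKernel, abs_of_pos this]
  · rw [intervalIntegral.integral_eq_sub_of_hasDerivAt
      (f := fun s : ℝ => Complex.log ((((s + 1 / s : ℝ)) : ℂ) - (z + 1 / z))) ?_ hint]
    · exact abs_im_log_sub_log_le (slit_joukowski_im_pos hz hz1 _) (slit_joukowski_im_pos hz hz1 _)
    · intro t ht
      refine (hasDerivAt_log_slit hz hz1 (hne t ht)).congr_deriv ?_
      have : t < 0 := by rw [Set.uIcc_of_le hab] at ht; exact ht.2.trans_lt h
      rw [slitKernel, abs_of_neg this]
      push_cast
      rw [neg_mul, div_neg]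

theorem abs_integral_slitKernel_subset_le {z : ℂ} (hz : 0 < z.im) (hz1 : ‖z‖ < 1) {a b : ℝ}
    (hab : a ≤ b) (h : 0 < a ∧ b ≤ 1 ∨ b < 0 ∧ -1 ≤ a) {s : Set ℝ} (hs : MeasurableSet s)
    (hsub : s ⊆ Set.Icc a b) :
    |(∫ t in s, slitKernel z t).im| ≤ Real.pi := by
  have hint : IntegrableOn (slitKernel z) (Set.Icc a b) := by
    refine (continuousOn_slitKernel hz.ne' ?_).integrableOn_compact isCompact_Icc
    intro t ht
    rcases h with h | h
    · exact (h.1.trans_le ht.1).ne'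
    · exact (ht.2.trans_lt h.1).ne
  have him : ∀ {r : Set ℝ}, IntegrableOn (slitKernel z) r →
      (∫ t in r, slitKernel z t).im = ∫ t in r, (slitKernel z t).im := by
    intro r hr
    exact (integral_im (𝕜 := ℂ) hr).symm
  have hbound := abs_integral_slitKernel_le hz hz1 hab (h.imp And.left And.left)
  rw [intervalIntegral.integral_of_le hab, ← integral_Icc_eq_integral_Ioc, him hint] at hbound
  rw [him (hint.mono_set hsub)]
  have hintim : IntegrableOn (fun t => (slitKernel z t).im) (Set.Icc a b) := hint.im
  refine le_trans ?_ hbound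
  rcases h with h | h
  · have hsign : ∀ t ∈ Set.Icc a b, 0 ≤ -(slitKernel z t).im := fun t ht => neg_nonneg.2
      (slitKernel_im_nonpos hz hz1 (h.1.trans_le ht.1) (ht.2.trans h.2))
    rw [← abs_neg, ← abs_neg (∫ t in Set.Icc a b, _), ← integral_neg, ← integral_neg,
      abs_of_nonneg (setIntegral_nonneg hs fun t ht => hsign t (hsub ht)),
      abs_of_nonneg (setIntegral_nonneg measurableSet_Icc hsign)]
    exact setIntegral_mono_set hintim.neg
      ((ae_restrict_mem measurableSet_Icc).mono hsign) hsub.eventuallyLE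
  · have hsign : ∀ t ∈ Set.Icc a b, 0 ≤ (slitKernel z t).im := fun t ht =>
      (slitKernel_im_nonneg hz hz1 (ht.2.trans_lt h.1) (h.2.trans ht.1))
    rw [abs_of_nonneg (setIntegral_nonneg hs fun t ht => hsign t (hsub ht)),
      abs_of_nonneg (setIntegral_nonneg measurableSet_Icc hsign)]
    exact setIntegral_mono_set hintim
      ((ae_restrict_mem measurableSet_Icc).mono hsign) hsub.eventuallyLE

theorem exists_pos_lt_abs_of_isCompact {K : Set ℝ} (hK : IsCompact K) (h0 : (0 : ℝ) ∉ K) :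
    ∃ a > 0, a < 1 ∧ ∀ t ∈ K, a ≤ |t| := by
  have : ∀ᶠ t in nhds (0 : ℝ), t ∉ K := hK.isClosed.isOpen_compl.mem_nhds h0
  obtain ⟨ε, hε, h⟩ := Metric.eventually_nhds_iff_ball.1 this
  refine ⟨min ε (1 / 2), by positivity, by linarith [min_le_right ε (1 / 2)], fun t ht => ?_⟩
  by_contra hlt
  push Not at hlt
  refine h t ?_ ht
  rw [mem_ball_zero_iff, Real.norm_eq_abs]
  exact hlt.trans_le (min_le_left _ _)

theorem slitFun_re_nonneg {K : Set ℝ} (hK : IsCompact K) (h0 : (0 : ℝ) ∉ K)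
    (hK1 : K ⊆ Set.Icc (-1) 1) {z : ℂ} (hz : 0 < z.im) (hz1 : ‖z‖ < 1) :
    0 ≤ (slitFun K z).re := by
  obtain ⟨a, ha, ha1, hKa⟩ := exists_pos_lt_abs_of_isCompact hK h0
  have hKm := hK.measurableSet
  have hp : K ∩ Set.Ioi 0 ⊆ Set.Icc a 1 := fun t ht =>
    ⟨by have := hKa t ht.1; rwa [abs_of_pos ht.2] at this, (hK1 ht.1).2⟩
  have hn : K \ Set.Ioi 0 ⊆ Set.Icc (-1) (-a) := fun t ht =>
    ⟨(hK1 ht.1).1, by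
      have h1 := hKa t ht.1
      have h2 : t ≤ 0 := not_lt.1 ht.2
      rw [abs_of_nonpos h2] at h1; linarith⟩
  have hpm : MeasurableSet (K ∩ Set.Ioi 0) := hKm.inter measurableSet_Ioi
  have hnm : MeasurableSet (K \ Set.Ioi 0) := hKm.diff measurableSet_Ioi
  have hint : IntegrableOn (slitKernel z) K :=
    (continuousOn_slitKernel hz.ne' (fun t ht h => h0 (h ▸ ht))).integrableOn_compact hK
  have hsplit : slitLog K z = (∫ t in K ∩ Set.Ioi 0, slitKernel z t) +
      ∫ t in K \ Set.Ioi 0, slitKernel z t :=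
    (integral_inter_add_sdiff measurableSet_Ioi hint).symm
  have b1 := abs_integral_slitKernel_subset_le hz hz1 ha1.le (Or.inl ⟨ha, le_rfl⟩) hpm hp
  have b2 := abs_integral_slitKernel_subset_le hz hz1 (by linarith)
    (Or.inr ⟨by linarith, le_rfl⟩) hnm hn
  have s1 : (∫ t in K ∩ Set.Ioi 0, slitKernel z t).im ≤ 0 := by
    rw [setIntegral_im (hint.mono_set inter_subset_left)]
    exact setIntegral_nonpos hpm fun t ht => slitKernel_im_nonpos hz hz1 ht.2 (hK1 ht.1).2
  have s2 : 0 ≤ (∫ t in K \ Set.Ioi 0, slitKernel z t).im := by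
    rw [setIntegral_im (hint.mono_set sdiff_subset)]
    refine setIntegral_nonneg hnm fun t ht => slitKernel_im_nonneg hz hz1 ?_ (hK1 ht.1).1
    have := (hn ht).2
    linarith
  have him : |(slitLog K z).im| ≤ Real.pi := by
    rw [hsplit, Complex.add_im]
    rw [abs_le] at *
    constructor <;> linarith
  rw [slitFun, Complex.exp_re]
  refine mul_nonneg (Real.exp_pos _).le (Real.cos_nonneg_of_mem_Icc ?_)
  rw [abs_le] at him
  rw [show (-slitLog K z / 2).im = -(slitLog K z).im / 2 by
    rw [show (-slitLog K z / 2) = ((-1 / 2 : ℝ) : ℂ) * slitLog K z by push_cast; ring,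
      Complex.im_ofReal_mul]; ring]
  constructor <;> linarith

/-- A holomorphic function on the upper half plane has a primitive there. -/
theorem exists_primitive_upperHalfPlane {f : ℂ → ℂ}
    (hf : ∀ z : ℂ, 0 < z.im → DifferentiableAt ℂ f z) :
    ∃ g : ℂ → ℂ, ∀ z : ℂ, 0 < z.im → HasDerivAt g (f z) z := by
  -- transport to the unit disc by the Cayley transform
  let c : ℂ → ℂ := fun w => I * (1 + w) / (1 - w)
  have hne : ∀ w ∈ ball (0 : ℂ) 1, 1 - w ≠ 0 := by
    intro w hw h
    have : w = 1 := (sub_eq_zero.1 h).symm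
    simp [this] at hw
  have hcd : ∀ w ∈ ball (0 : ℂ) 1, HasDerivAt c (2 * I / (1 - w) ^ 2) w := by
    intro w hw
    have h := (((hasDerivAt_id' w).const_add (1 : ℂ)).const_mul I).fun_div
      ((hasDerivAt_id' w).const_sub (1 : ℂ)) (hne w hw)
    refine h.congr_deriv ?_
    ring
  have hcim : ∀ w ∈ ball (0 : ℂ) 1, 0 < (c w).im := by
    intro w hw
    rw [mem_ball_zero_iff] at hw
    have h1 : Complex.normSq w < 1 := by
      rw [Complex.normSq_eq_norm_sq]; nlinarith [norm_nonneg w]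
    have h2 : 0 < Complex.normSq (1 - w) :=
      Complex.normSq_pos.2 (hne w (mem_ball_zero_iff.2 hw))
    have : (c w).im = (1 - Complex.normSq w) / Complex.normSq (1 - w) := by
      simp only [c, Complex.div_im]
      rw [div_sub_div_same]
      congr 1
      simp [Complex.normSq_apply]
      ring
    rw [this]
    exact div_pos (by linarith) h2
  have hF : DifferentiableOn ℂ (fun w => f (c w) * (2 * I / (1 - w) ^ 2)) (ball 0 1) := by
    intro w hw
    have h1 : DifferentiableAt ℂ (fun w => f (c w)) w :=
      (hf _ (hcim w hw)).comp w (hcd w hw).differentiableAt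
    have h2 : DifferentiableAt ℂ (fun w : ℂ => 2 * I / (1 - w) ^ 2) w :=
      DifferentiableAt.fun_div (by fun_prop) (by fun_prop) (pow_ne_zero 2 (hne w hw))
    exact (h1.mul h2).differentiableWithinAt
  obtain ⟨g, hg⟩ := hF.isExactOn_ball
  refine ⟨fun z => g ((z - I) / (z + I)), fun z hz => ?_⟩
  have hzI : z + I ≠ 0 := by
    intro h
    have := congrArg Complex.im h
    simp at this
    linarith
  have hmem : (z - I) / (z + I) ∈ ball (0 : ℂ) 1 := by
    rw [mem_ball_zero_iff, norm_div, div_lt_one (norm_pos_iff.2 hzI)]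
    rw [← sq_lt_sq₀ (norm_nonneg _) (norm_nonneg _), ← Complex.normSq_eq_norm_sq,
      ← Complex.normSq_eq_norm_sq]
    simp [Complex.normSq_apply]
    nlinarith
  have hd : HasDerivAt (fun z : ℂ => (z - I) / (z + I)) (2 * I / (z + I) ^ 2) z := by
    refine (((hasDerivAt_id' z).sub_const I).fun_div
      ((hasDerivAt_id' z).add_const I) hzI).congr_deriv ?_
    ring
  have e1 : 1 - (z - I) / (z + I) = 2 * I / (z + I) := by field_simp; ring
  have hI : (I : ℂ) ≠ 0 := I_ne_zero
  have hc : c ((z - I) / (z + I)) = z := by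
    simp only [c]
    rw [e1]
    field_simp
    ring
  refine ((hg _ hmem).comp z hd).congr_deriv ?_
  beta_reduce
  rw [hc, e1]
  field_simp

/-- The real linear functional `v ↦ Re (a v)`. -/
noncomputable def reMul (a : ℂ) : ℂ →L[ℝ] ℝ := reCLM.comp (ContinuousLinearMap.mul ℝ ℂ a)

theorem reMul_apply (a v : ℂ) : reMul a v = (a * v).re := rfl

theorem norm_reMul_le (a : ℂ) : ‖reMul a‖ ≤ ‖a‖ :=
  ContinuousLinearMap.opNorm_le_bound _ (norm_nonneg a) fun v => by
    rw [reMul_apply, Real.norm_eq_abs, ← norm_mul]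
    exact Complex.abs_re_le_norm _

theorem HasDerivAt.hasFDerivAt_re {f : ℂ → ℂ} {a z : ℂ} (h : HasDerivAt f a z) :
    HasFDerivAt (fun w => (f w).re) (reMul a) z := by
  have := (h.hasFDerivAt.restrictScalars ℝ)
  refine (reCLM.hasFDerivAt.comp z this).congr_fderiv ?_
  ext v
  simp [reMul_apply]
  ring

/-- The open strip of height `π`. -/
def openStrip : Set ℂ := {ζ | ζ.im ∈ Set.Ioo 0 Real.pi}

theorem isOpen_openStrip : IsOpen openStrip := isOpen_Ioo.preimage continuous_im

theorem convex_openStrip : Convex ℝ openStrip :=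
  (convex_Ioo 0 Real.pi).is_linear_preimage imLm.isLinear

theorem exp_im_pos_of_mem_openStrip {ζ : ℂ} (h : ζ ∈ openStrip) : 0 < (Complex.exp ζ).im := by
  rw [Complex.exp_im]
  exact mul_pos (Real.exp_pos _) (Real.sin_pos_of_mem_Ioo h)

theorem mem_closure_openStrip {ζ : ℂ} (h : ζ.im ∈ Set.Icc 0 Real.pi) : ζ ∈ closure openStrip := by
  have : closure openStrip = {ζ : ℂ | ζ.im ∈ Set.Icc 0 Real.pi} := by
    have h1 : openStrip = im ⁻¹' Set.Ioo 0 Real.pi := rfl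
    rw [h1, closure_preimage_im, closure_Ioo Real.pi_pos.ne]
    rfl
  rw [this]; exact h

/-- A function with derivative locally bounded near a boundary point has a limit there. -/
theorem exists_tendsto_of_hasFDerivAt_bounded {s : Set ℂ} (hs : Convex ℝ s) {n : ℂ → ℝ}
    {n' : ℂ → ℂ →L[ℝ] ℝ} (hn : ∀ ζ ∈ s, HasFDerivAt n (n' ζ) ζ) {ζ₀ : ℂ} {M : ℝ}
    (hM : ∀ᶠ ζ in nhds ζ₀, ζ ∈ s → ‖n' ζ‖ ≤ M) :
    ∃ y, Tendsto n (nhdsWithin ζ₀ s) (nhds y) := by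
  obtain ⟨ε, hε, h⟩ := Metric.eventually_nhds_iff_ball.1 hM
  have hlip : LipschitzOnWith M.toNNReal n (ball ζ₀ ε ∩ s) :=
    ((convex_ball ζ₀ ε).inter hs).lipschitzOnWith_of_nnnorm_hasFDerivWithin_le
      (fun ζ hζ => (hn ζ hζ.2).hasFDerivWithinAt) (fun ζ hζ => by
        rw [← NNReal.coe_le_coe, coe_nnnorm]
        exact (h ζ hζ.1 hζ.2).trans (Real.le_coe_toNNReal M))
  obtain ⟨g, hg, hng⟩ := hlip.extend_real
  refine ⟨g ζ₀, ?_⟩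
  have h1 : Tendsto g (nhdsWithin ζ₀ s) (nhds (g ζ₀)) :=
    hg.continuous.continuousAt.tendsto.mono_left nhdsWithin_le_nhds
  refine h1.congr' ?_
  filter_upwards [self_mem_nhdsWithin, mem_nhdsWithin_of_mem_nhds (ball_mem_nhds ζ₀ hε)]
    with ζ h1 h2
  exact (hng ⟨h2, h1⟩).symm

theorem slit_denominator_ne_zero_of_not_mem {K : Set ℝ} (hK1 : K ⊆ Set.Ioo (-1) 1) {z : ℂ}
    (hz1 : ‖z‖ ≤ 1) (hz : ∀ t ∈ K, z ≠ t) :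
    ∀ t ∈ K, (z - (t : ℂ)) * (1 - (t : ℂ) * z) ≠ 0 := by
  intro t ht
  refine mul_ne_zero (sub_ne_zero.2 (hz t ht)) fun h => ?_
  have h1 : (t : ℂ) * z = 1 := (sub_eq_zero.1 h).symm
  have h2 : |t| * ‖z‖ = 1 := by
    have := congrArg norm h1
    simpa using this
  have h3 : |t| < 1 := abs_lt.2 (hK1 ht)
  nlinarith [norm_nonneg z, abs_nonneg t]

theorem norm_exp_le_one {ζ : ℂ} (h : ζ.re ≤ 0) : ‖Complex.exp ζ‖ ≤ 1 := by
  rw [Complex.norm_exp]; exact Real.exp_le_one_iff.2 h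

/-- Half of the closed strip together with the real directions not meeting `K`. -/
def closedHalfStrip (K : Set ℝ) : Set ℂ :=
  {ζ | ζ.im ∈ Set.Icc 0 Real.pi ∧ ζ.re ≤ 0 ∧ ∀ t ∈ K, Complex.exp ζ ≠ t}

theorem differentiableAt_slitFun_exp {K : Set ℝ} (hK : IsCompact K) (h0 : (0 : ℝ) ∉ K)
    (hK1 : K ⊆ Set.Ioo (-1) 1) {ζ : ℂ} (hζ : ζ.re ≤ 0 ∧ ∀ t ∈ K, Complex.exp ζ ≠ t) :
    DifferentiableAt ℂ (fun ζ => slitFun K (Complex.exp ζ)) ζ :=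
  (differentiableAt_slitFun hK h0 (slit_denominator_ne_zero_of_not_mem hK1
    (norm_exp_le_one hζ.1) hζ.2)).comp ζ Complex.differentiable_exp.differentiableAt

theorem differentiableAt_slitFun_exp_openStrip {K : Set ℝ} (hK : IsCompact K) (h0 : (0 : ℝ) ∉ K)
    {ζ : ℂ} (hζ : ζ ∈ openStrip) :
    DifferentiableAt ℂ (fun ζ => slitFun K (Complex.exp ζ)) ζ :=
  (differentiableAt_slitFun hK h0 fun t _ => slit_denominator_ne_zero
    (exp_im_pos_of_mem_openStrip hζ).ne' t).comp ζ Complex.differentiable_exp.differentiableAt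

theorem slitFun_circle_im {K : Set ℝ} {z : ℂ} (hz : ‖z‖ = 1) : (slitFun K z).im = 0 := by
  rw [slitFun_circle K z hz, Complex.ofReal_im]

theorem exists_strip_potential {K : Set ℝ} (hK : IsCompact K) (h0 : (0 : ℝ) ∉ K)
    (hK1 : K ⊆ Set.Ioo (-1) 1) :
    ∃ n : ℂ → ℝ,
      (∀ ζ ∈ openStrip, HasFDerivAt n (reMul (-slitFun K (Complex.exp ζ))) ζ) ∧
      ContinuousOn n (closedHalfStrip K) ∧
      (∀ τ ∈ Set.Icc 0 Real.pi, n (τ * I) = 0) ∧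
      (∀ ζ ∈ openStrip, ζ.re ≤ 0 → 0 ≤ n ζ) ∧
      ∃ C M s₀ : ℝ, ∀ ζ ∈ openStrip, ζ.re ≤ s₀ → |n ζ| ≤ C + M * |ζ.re| := by
  have hpi := Real.pi_pos
  let T : ℂ → ℂ := fun ζ => slitFun K (Complex.exp ζ)
  obtain ⟨g, hg⟩ := exists_primitive_upperHalfPlane (f := fun z => -(slitFun K z) / z)
    (fun z hz => by
      refine DifferentiableAt.fun_div ?_ differentiableAt_fun_id (by rintro rfl; simp at hz)
      exact (differentiableAt_slitFun hK h0 fun t _ => slit_denominator_ne_zero hz.ne' t).neg)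
  let N₁ : ℂ → ℝ := fun ζ => (g (Complex.exp ζ)).re
  have hN₁ : ∀ ζ ∈ openStrip, HasFDerivAt N₁ (reMul (-T ζ)) ζ := by
    intro ζ hζ
    have h := ((hg _ (exp_im_pos_of_mem_openStrip hζ)).comp ζ (Complex.hasDerivAt_exp ζ))
    have h' := h.congr_deriv (g' := -T ζ) (by field_simp [Complex.exp_ne_zero]; rfl)
    exact h'.hasFDerivAt_re
  let N : ℂ → ℝ := fun ζ => N₁ ζ - N₁ ((Real.pi / 2 : ℝ) * I)
  have hN : ∀ ζ ∈ openStrip, HasFDerivAt N (reMul (-T ζ)) ζ := fun ζ hζ => (hN₁ ζ hζ).sub_const _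
  have hTc : ∀ ζ ∈ closedHalfStrip K, ContinuousAt T ζ := fun ζ hζ =>
    (differentiableAt_slitFun_exp hK h0 hK1 hζ.2).continuousAt
  have hNlim : ∀ ζ ∈ closedHalfStrip K, ∃ y, Tendsto N (nhdsWithin ζ openStrip) (nhds y) := by
    intro ζ hζ
    refine exists_tendsto_of_hasFDerivAt_bounded convex_openStrip hN (M := ‖T ζ‖ + 1) ?_
    have : ∀ᶠ ξ in nhds ζ, ‖T ξ‖ < ‖T ζ‖ + 1 :=
      (hTc ζ hζ).norm.eventually_lt_const (lt_add_one _)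
    filter_upwards [this] with ξ hξ _
    refine (norm_reMul_le _).trans ?_
    rw [norm_neg]; exact hξ.le
  have hNcont : ContinuousOn N openStrip := fun ζ hζ => (hN ζ hζ).continuousAt.continuousWithinAt
  let n : ℂ → ℝ := extendFrom openStrip N
  have hnN : ∀ ζ ∈ openStrip, n ζ = N ζ := extendFrom_extends hNcont
  have hncont : ContinuousOn n (closedHalfStrip K) :=
    continuousOn_extendFrom (fun ζ hζ => mem_closure_openStrip hζ.1) hNlim
  have hn : ∀ ζ ∈ openStrip, HasFDerivAt n (reMul (-T ζ)) ζ := by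
    intro ζ hζ
    refine (hN ζ hζ).congr_of_eventuallyEq ?_
    filter_upwards [isOpen_openStrip.mem_nhds hζ] with ξ hξ using hnN ξ hξ
  -- derivatives along horizontal and vertical lines
  have hhor : ∀ τ ∈ Set.Ioo 0 Real.pi, ∀ s : ℝ,
      HasDerivAt (fun s : ℝ => n (s + τ * I)) (-(T (s + τ * I)).re) s := by
    intro τ hτ s
    have hm : (s + τ * I : ℂ) ∈ openStrip := by simpa [openStrip] using hτ
    have h1 : HasDerivAt (fun s : ℝ => (s + τ * I : ℂ)) 1 s :=
      (Complex.ofRealCLM.hasDerivAt (x := s)).add_const _ |>.congr_deriv (by simp)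
    have := (hn _ hm).comp_hasDerivAt s h1
    refine this.congr_deriv ?_
    simp [reMul_apply]
  have hver : ∀ τ ∈ Set.Ioo 0 Real.pi,
      HasDerivAt (fun τ : ℝ => n (τ * I)) 0 τ := by
    intro τ hτ
    have hm : (τ * I : ℂ) ∈ openStrip := by simpa [openStrip] using hτ
    have h1 : HasDerivAt (fun τ : ℝ => (τ * I : ℂ)) I τ :=
      ((Complex.ofRealCLM.hasDerivAt (x := τ)).mul_const I).congr_deriv (by simp)
    have := (hn _ hm).comp_hasDerivAt τ h1
    refine this.congr_deriv ?_
    have hT : (T (τ * I)).im = 0 := slitFun_circle_im (Complex.norm_exp_ofReal_mul_I τ)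
    simp [reMul_apply, hT]
  have hone : ∀ τ : ℝ, ∀ t ∈ K, Complex.exp (τ * I) ≠ t := by
    intro τ t ht h
    have := congrArg norm h
    rw [Complex.norm_exp_ofReal_mul_I, Complex.norm_real, Real.norm_eq_abs] at this
    have h3 : |t| < 1 := abs_lt.2 (hK1 ht)
    linarith
  have hzero : ∀ τ ∈ Set.Icc 0 Real.pi, n (τ * I) = 0 := by
    have hc : ContinuousOn (fun τ : ℝ => n (τ * I)) (Set.Icc 0 Real.pi) := by
      refine hncont.comp (f := fun τ : ℝ => (τ * I : ℂ)) (by fun_prop) fun τ hτ => ?_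
      exact ⟨by simpa using hτ, by simp, hone τ⟩
    have hdiff : DifferentiableOn ℝ (fun τ : ℝ => n (τ * I)) (interior (Set.Icc 0 Real.pi)) := by
      rw [interior_Icc]
      exact fun τ hτ => (hver τ hτ).differentiableAt.differentiableWithinAt
    have hder : ∀ τ ∈ interior (Set.Icc 0 Real.pi), deriv (fun τ : ℝ => n (τ * I)) τ = 0 := by
      rw [interior_Icc]
      exact fun τ hτ => (hver τ hτ).deriv
    have hmono := monotoneOn_of_deriv_nonneg (convex_Icc 0 Real.pi) hc hdiff
      fun τ hτ => (hder τ hτ).ge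
    have hanti := antitoneOn_of_deriv_nonpos (convex_Icc 0 Real.pi) hc hdiff
      fun τ hτ => (hder τ hτ).le
    have hhalf : Real.pi / 2 ∈ Set.Icc 0 Real.pi := ⟨by linarith, by linarith⟩
    have hmid : n ((Real.pi / 2 : ℝ) * I) = 0 := by
      rw [hnN _ (by
        simp only [openStrip, mem_ofPred_eq, Complex.im_ofReal_mul, I_im,
          mul_one]
        exact ⟨by linarith, by linarith⟩)]
      exact sub_self _
    intro τ hτ
    rw [← hmid]
    rcases le_total τ (Real.pi / 2) with h | h
    · exact le_antisymm (hmono hτ hhalf h) (hanti hτ hhalf h)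
    · exact le_antisymm (hanti hhalf hτ h) (hmono hhalf hτ h)
  refine ⟨n, hn, hncont, hzero, ?_, ?_⟩
  · intro ζ hζ hre
    have hanti : AntitoneOn (fun s : ℝ => n (s + ζ.im * I)) (Set.Iic 0) := by
      refine antitoneOn_of_deriv_nonpos (convex_Iic 0)
        (fun s _ => (hhor _ hζ s).continuousAt.continuousWithinAt)
        (fun s _ => (hhor _ hζ s).differentiableAt.differentiableWithinAt) fun s hs => ?_
      rw [(hhor _ hζ s).deriv, neg_nonpos]
      rw [interior_Iic] at hs
      have hm : (s + ζ.im * I : ℂ) ∈ openStrip := by simpa [openStrip] using hζ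
      refine slitFun_re_nonneg hK h0 (hK1.trans Ioo_subset_Icc_self)
        (exp_im_pos_of_mem_openStrip hm) ?_
      rw [Complex.norm_exp]
      simpa using hs
    have := hanti (a := ζ.re) (b := 0) hre (by simp) hre
    simp only [Complex.re_add_im, Complex.ofReal_zero, zero_add] at this
    rw [hzero _ (Ioo_subset_Icc_self hζ)] at this
    exact this
  · obtain ⟨a, ha, ha1, hKa⟩ := exists_pos_lt_abs_of_isCompact hK h0
    have hz : ContinuousAt (slitFun K) 0 := by
      refine (differentiableAt_slitFun hK h0 fun t ht => ?_).continuousAt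
      have : t ≠ 0 := fun h => h0 (h ▸ ht)
      simpa using this
    obtain ⟨δ, hδ, hb⟩ := Metric.eventually_nhds_iff_ball.1
      (hz.norm.eventually_lt_const (lt_add_one ‖slitFun K 0‖))
    set M := ‖slitFun K 0‖ + 1
    let r := min (δ / 2) (a / 2)
    have hr : 0 < r := by positivity
    have hra : r < a := (min_le_right _ _).trans_lt (by linarith)
    have hrδ : r < δ := (min_le_left _ _).trans_lt (by linarith)
    let s₀ := Real.log r
    have hs₀ : s₀ ≤ 0 := Real.log_nonpos hr.le (by linarith)
    have hes : Real.exp s₀ = r := Real.exp_log hr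
    have hseg : ContinuousOn (fun τ : ℝ => n (s₀ + τ * I)) (Set.Icc 0 Real.pi) := by
      refine hncont.comp (f := fun τ : ℝ => (s₀ + τ * I : ℂ)) (by fun_prop) fun τ hτ => ?_
      refine ⟨by simpa using hτ, by simpa using hs₀, fun t ht h => ?_⟩
      have := congrArg norm h
      rw [Complex.norm_exp, Complex.norm_real, Real.norm_eq_abs] at this
      have h2 := hKa t ht
      simp [hes] at this
      linarith
    obtain ⟨C, hC⟩ := isCompact_Icc.exists_bound_of_continuousOn hseg
    refine ⟨C, M, s₀, fun ζ hζ hre => ?_⟩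
    have hbd := (convex_Iic s₀).norm_image_sub_le_of_norm_hasDerivWithin_le
      (f := fun s : ℝ => n (s + ζ.im * I)) (C := M)
      (fun s _ => (hhor _ hζ s).hasDerivWithinAt) (fun s hs => ?_)
      (x := s₀) (y := ζ.re) (by simp) hre
    · have h1 := hC ζ.im (Ioo_subset_Icc_self hζ)
      simp only [Complex.re_add_im] at hbd
      have h3 : ‖n ζ‖ ≤ ‖n (s₀ + ζ.im * I)‖ + ‖n ζ - n (s₀ + ζ.im * I)‖ := by
        have := norm_add_le (n (s₀ + ζ.im * I)) (n ζ - n (s₀ + ζ.im * I))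
        simpa using this
      have h4 : ‖ζ.re - s₀‖ ≤ |ζ.re| := by
        rw [Real.norm_eq_abs, abs_of_nonpos (by linarith), abs_of_nonpos (by linarith)]
        linarith
      have hM : 0 ≤ M := by positivity
      have := mul_le_mul_of_nonneg_left h4 hM
      rw [← Real.norm_eq_abs]
      linarith
    · rw [norm_neg]
      refine (Complex.abs_re_le_norm _).trans (hb _ ?_).le
      rw [mem_ball_zero_iff, Complex.norm_exp]
      have : Real.exp s ≤ Real.exp s₀ := Real.exp_le_exp.2 hs
      simp
      linarith

theorem strip_green_inequality {T G : ℂ → ℂ} {n v : ℂ → ℝ} {χ k k' : ℝ → ℝ} {s : ℝ} (hs : s < 0)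
    (hT : ∀ ζ ∈ openStrip, DifferentiableAt ℂ T ζ)
    (hG : ∀ ζ ∈ openStrip, ζ.re < 0 → DifferentiableAt ℂ G ζ)
    (hn : ∀ ζ ∈ openStrip, HasFDerivAt n (reMul (-T ζ)) ζ)
    (hv : ∀ ζ ∈ openStrip, ζ.re < 0 → HasFDerivAt v (reMul (G ζ)) ζ)
    (hχ : ∀ x, HasDerivAt χ (k x) x) (hk : ∀ x, HasDerivAt k (k' x) x) (hk0 : ∀ x, 0 ≤ k' x)
    (hn0 : ∀ ζ ∈ openStrip, ζ.re ≤ 0 → 0 ≤ n ζ)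
    (hqc : ContinuousOn (fun ζ => χ (v ζ) • T ζ + n ζ • k (v ζ) • G ζ)
      (Set.Icc s 0 ×ℂ Set.Icc 0 Real.pi))
    (hdc : ContinuousOn (fun ζ => n ζ * (k' (v ζ) * Complex.normSq (G ζ)))
      (Set.Icc s 0 ×ℂ Set.Icc 0 Real.pi))
    (hbot : ∀ x ∈ Set.Icc s 0, ∀ y : ℝ, y = 0 ∨ y = Real.pi →
      (χ (v (x + y * I)) • T (x + y * I) + n (x + y * I) • k (v (x + y * I)) • G (x + y * I)).im
        = 0) :
    (∫ y in (0 : ℝ)..Real.pi, (χ (v (s + y * I)) • T (s + y * I) +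
      n (s + y * I) • k (v (s + y * I)) • G (s + y * I)).re) ≤
    ∫ y in (0 : ℝ)..Real.pi, (χ (v ((0 : ℝ) + y * I)) • T ((0 : ℝ) + y * I) +
      n ((0 : ℝ) + y * I) • k (v ((0 : ℝ) + y * I)) • G ((0 : ℝ) + y * I)).re := by
  have hpi := Real.pi_pos
  set q : ℂ → ℂ := fun ζ => χ (v ζ) • T ζ + n ζ • k (v ζ) • G ζ with hq
  let lin : ℂ → ℂ →L[ℝ] ℂ := fun a => ContinuousLinearMap.mul ℝ ℂ a
  let q' : ℂ → ℂ →L[ℝ] ℂ := fun ζ => (χ (v ζ) • lin (deriv T ζ) +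
    (k (v ζ) • reMul (G ζ)).smulRight (T ζ)) +
    (n ζ • (k (v ζ) • lin (deriv G ζ) + (k' (v ζ) • reMul (G ζ)).smulRight (G ζ)) +
      (reMul (-T ζ)).smulRight (k (v ζ) • G ζ))
  have hlin : ∀ {f : ℂ → ℂ} {ζ : ℂ}, DifferentiableAt ℂ f ζ → HasFDerivAt f (lin (deriv f ζ)) ζ := by
    intro f ζ hf
    refine (hf.hasDerivAt.hasFDerivAt.restrictScalars ℝ).congr_fderiv ?_
    ext w
    simp [lin, mul_comm]
  have hqd : ∀ ζ ∈ openStrip, ζ.re < 0 → HasFDerivAt q (q' ζ) ζ := by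
    intro ζ hζ hre
    have h1 : HasFDerivAt (fun ζ => χ (v ζ)) (k (v ζ) • reMul (G ζ)) ζ :=
      (hχ _).comp_hasFDerivAt ζ (hv ζ hζ hre)
    have h2 : HasFDerivAt (fun ζ => k (v ζ)) (k' (v ζ) • reMul (G ζ)) ζ :=
      (hk _).comp_hasFDerivAt ζ (hv ζ hζ hre)
    exact (h1.smul (hlin (hT ζ hζ))).add ((hn ζ hζ).smul (h2.smul (hlin (hG ζ hζ hre))))
  let e : ℝ × ℝ →L[ℝ] ℂ := (equivRealProdCLM.symm : ℝ × ℝ →L[ℝ] ℂ)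
  have he : ∀ p : ℝ × ℝ, e p = p.1 + p.2 * I := fun p => mk_eq_add_mul_I p.1 p.2
  have hmaps : MapsTo e (Set.Icc s 0 ×ˢ Set.Icc 0 Real.pi) (Set.Icc s 0 ×ℂ Set.Icc 0 Real.pi) :=
    fun p hp => hp
  have hdiv : ∀ p : ℝ × ℝ, (reCLM.comp ((q' (e p)).comp e)) (1, 0) +
      (-(imCLM.comp ((q' (e p)).comp e))) (0, 1) =
      n (e p) * (k' (v (e p)) * Complex.normSq (G (e p))) := by
    intro p
    have e1 : e (1, 0) = 1 := by rw [he]; simp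
    have e2 : e (0, 1) = I := by rw [he]; simp
    simp only [q', lin, ContinuousLinearMap.comp_apply, neg_apply, e1, e2,
      add_apply, smul_apply,
      ContinuousLinearMap.smulRight_apply, reMul_apply, reCLM_apply, imCLM_apply,
      ContinuousLinearMap.mul_apply', Complex.add_re, Complex.add_im, Complex.smul_re,
      Complex.smul_im, Complex.mul_re, Complex.mul_im, Complex.neg_re, Complex.neg_im,
      Complex.I_re, Complex.I_im, Complex.one_re, Complex.one_im, smul_eq_mul,
      Complex.normSq_apply]
    ring
  have hgreen := integral2_divergence_prod_of_hasFDerivAt_off_countable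
    (fun p => (q (e p)).re) (fun p => -(q (e p)).im)
    (fun p => reCLM.comp ((q' (e p)).comp e)) (fun p => -(imCLM.comp ((q' (e p)).comp e)))
    s 0 0 Real.pi ∅ Set.countable_empty
    (by
      rw [Set.uIcc_of_le hs.le, Set.uIcc_of_le hpi.le]
      exact continuous_re.comp_continuousOn (hqc.comp e.continuous.continuousOn hmaps))
    (by
      rw [Set.uIcc_of_le hs.le, Set.uIcc_of_le hpi.le]
      exact (continuous_im.comp_continuousOn (hqc.comp e.continuous.continuousOn hmaps)).neg)
    (fun p hp => by
      rw [min_eq_left hs.le, max_eq_right hs.le, min_eq_left hpi.le, max_eq_right hpi.le] at hp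
      exact reCLM.hasFDerivAt.comp p ((hqd (e p) hp.1.2 hp.1.1.2).comp p e.hasFDerivAt))
    (fun p hp => by
      rw [min_eq_left hs.le, max_eq_right hs.le, min_eq_left hpi.le, max_eq_right hpi.le] at hp
      exact (imCLM.hasFDerivAt.comp p ((hqd (e p) hp.1.2 hp.1.1.2).comp p e.hasFDerivAt)).neg)
    (by
      rw [Set.uIcc_of_le hs.le, Set.uIcc_of_le hpi.le]
      simp only [hdiv]
      exact (hdc.comp e.continuous.continuousOn hmaps).integrableOn_compact
        (isCompact_Icc.prod isCompact_Icc))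
  simp only [hdiv] at hgreen
  simp only [he] at hgreen
  have hside : ∀ y : ℝ, y = 0 ∨ y = Real.pi →
      ∫ x in s..0, -(q ((x : ℂ) + (y : ℂ) * I)).im = 0 := by
    intro y hy
    rw [intervalIntegral.integral_congr (g := fun _ => (0 : ℝ)) fun x hx => ?_]
    · simp
    · rw [Set.uIcc_of_le hs.le] at hx
      exact neg_eq_zero.2 (hbot x hx y hy)
  rw [hside _ (Or.inr rfl), hside _ (Or.inl rfl), sub_zero, zero_add] at hgreen
  have hnonneg : 0 ≤ ∫ x in s..0, ∫ y in (0 : ℝ)..Real.pi, n ((x : ℂ) + (y : ℂ) * I) *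
      (k' (v ((x : ℂ) + (y : ℂ) * I)) * Complex.normSq (G ((x : ℂ) + (y : ℂ) * I))) := by
    refine intervalIntegral.integral_nonneg hs.le fun x hx => ?_
    rw [intervalIntegral.integral_of_le hpi.le, integral_Ioc_eq_integral_Ioo]
    refine setIntegral_nonneg measurableSet_Ioo fun y hy => ?_
    exact mul_nonneg (hn0 _ (by simpa [openStrip] using hy) (by simpa using hx.2))
      (mul_nonneg (hk0 _) (Complex.normSq_nonneg _))
  rw [hgreen] at hnonneg
  exact sub_nonneg.1 hnonneg

theorem exists_smooth_ramp {ε : ℝ} (hε : 0 < ε) :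
    ∃ χ k k' : ℝ → ℝ, (∀ x, HasDerivAt χ (k x) x) ∧ (∀ x, HasDerivAt k (k' x) x) ∧
      Continuous k' ∧ (∀ x, 0 ≤ k' x) ∧ (∀ x, |k x| ≤ 1) ∧
      (∀ x < ε, χ x = 0 ∧ k x = 0 ∧ k' x = 0) ∧ (∀ x, x - 2 * ε ≤ χ x) ∧
      (∀ x ≤ 1, χ x ≤ 1) := by
  let k : ℝ → ℝ := fun x => Real.smoothTransition ((x - ε) / ε)
  have hkd : ContDiff ℝ 1 k := Real.smoothTransition.contDiff.comp (by fun_prop)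
  have hkc : Continuous k := hkd.continuous
  have hk1 : ∀ x, k x ≤ 1 := fun x => Real.smoothTransition.le_one _
  have hk0 : ∀ x, 0 ≤ k x := fun x => Real.smoothTransition.nonneg _
  have hkm : Monotone k := Real.smoothTransition.monotone.comp fun x y hxy => by
    show (x - ε) / ε ≤ (y - ε) / ε
    gcongr
  have hkz : ∀ x ≤ ε, k x = 0 := fun x hx =>
    Real.smoothTransition.zero_of_nonpos (div_nonpos_of_nonpos_of_nonneg (by linarith) hε.le)
  have hko : ∀ x, 2 * ε ≤ x → k x = 1 := fun x hx =>
    Real.smoothTransition.one_of_one_le ((one_le_div hε).2 (by linarith))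
  have hint : ∀ a b, IntervalIntegrable k volume a b := fun a b => hkc.intervalIntegrable a b
  have hadd : ∀ a b, (∫ t in (0 : ℝ)..a, k t) + ∫ t in a..b, k t = ∫ t in (0 : ℝ)..b, k t :=
    fun a b => intervalIntegral.integral_add_adjacent_intervals (hint _ _) (hint _ _)
  have hnn : ∀ a b, a ≤ b → 0 ≤ ∫ t in a..b, k t := fun a b hab =>
    intervalIntegral.integral_nonneg hab fun x _ => hk0 x
  have hχz : ∀ x ≤ ε, ∫ t in (0 : ℝ)..x, k t = 0 := by
    intro x hx
    rw [intervalIntegral.integral_congr (g := fun _ => (0 : ℝ)) fun t ht => hkz t ?_]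
    · simp
    · exact ht.2.trans (max_le hε.le hx)
  refine ⟨fun x => ∫ t in (0 : ℝ)..x, k t, k, deriv k, fun x => ?_, fun x => ?_,
    hkd.continuous_deriv le_rfl, fun x => hkm.deriv_nonneg, fun x => ?_, fun x hx => ⟨?_, ?_, ?_⟩,
    fun x => ?_, fun x hx => ?_⟩
  · exact intervalIntegral.integral_hasDerivAt_right (hint _ _)
      (hkc.stronglyMeasurableAtFilter _ _) hkc.continuousAt
  · exact (hkd.differentiable one_ne_zero x).hasDerivAt
  · rw [abs_of_nonneg (hk0 x)]; exact hk1 x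
  · exact hχz x hx.le
  · exact hkz x hx.le
  · have : k =ᶠ[nhds x] fun _ => (0 : ℝ) := by
      filter_upwards [Iio_mem_nhds hx] with y hy using hkz y (le_of_lt hy)
    rw [this.deriv_eq, deriv_const]
  · beta_reduce
    rcases le_total x (2 * ε) with h | h
    · rcases le_total x 0 with h0 | h0
      · rw [hχz x (by linarith)]; linarith
      · have := hnn 0 x h0; linarith
    · have h1 := hnn 0 (2 * ε) (by linarith)
      have h2 : ∫ t in (2 * ε)..x, k t = x - 2 * ε := by
        rw [intervalIntegral.integral_congr (g := fun _ => (1 : ℝ)) fun t ht => hko t ?_]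
        · simp
        · rw [Set.uIcc_of_le h] at ht; exact ht.1
      have h3 := hadd (2 * ε) x
      linarith
  · beta_reduce
    rcases le_total x 0 with h0 | h0
    · rw [hχz x (by linarith)]; exact zero_le_one
    · have : ∫ t in (0 : ℝ)..x, k t ≤ ∫ t in (0 : ℝ)..x, (1 : ℝ) :=
        intervalIntegral.integral_mono_on h0 (hint _ _) (by simp) fun t _ => hk1 t
      simp at this
      linarith

theorem disc_value_le {K L : Set ℝ} (hK : IsCompact K) (h0 : (0 : ℝ) ∉ L)
    (hK1 : K ⊆ Set.Ioo (-1) 1) (hKL : K ⊆ L)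
    {R : ℝ} (hR : 1 < R) {u : ℂ → ℝ} {h : ℂ → ℂ}
    (hu : ∀ z : ℂ, ‖z‖ < R → (∀ t ∈ L, z ≠ t) → HasFDerivAt u (reMul (h z)) z)
    (hh : ∀ z : ℂ, ‖z‖ < R → (∀ t ∈ L, z ≠ t) → DifferentiableAt ℂ h z)
    (hreal : ∀ x : ℝ, |x| < R → x ∉ L → (h x).im = 0)
    (huL : ∀ t ∈ L, u t = 0) (huc : ∀ t ∈ L, |t| < R → ContinuousAt u t)
    (hu1 : ∀ z : ℂ, ‖z‖ < R → u z ≤ 1) :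
    Real.pi * u 0 ≤
      ∫ τ in (0 : ℝ)..Real.pi, Real.exp (-(∫ t in K, poissonCos t (Real.cos τ)) / 2) := by
  have hpi := Real.pi_pos
  have h0K : (0 : ℝ) ∉ K := fun h => h0 (hKL h)
  obtain ⟨n, hn, hnc, hnz, hnn, C, M, s₀, hnb⟩ := exists_strip_potential hK h0K hK1
  set φ : ℝ → ℝ := fun τ => Real.exp (-(∫ t in K, poissonCos t (Real.cos τ)) / 2) with hφ
  have hexpT : ∀ τ : ℝ, slitFun K (Complex.exp (τ * I)) = φ τ := by
    intro τ
    rw [slitFun_circle K _ (Complex.norm_exp_ofReal_mul_I τ), Complex.exp_ofReal_mul_I_re]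
  have h0L : ∀ t ∈ L, (0 : ℂ) ≠ t := fun t ht h => h0 (by
    have : t = 0 := by exact_mod_cast h.symm
    exact this ▸ ht)
  have hclosedK : IsClosed (Complex.ofReal '' K) :=
    Complex.isometry_ofReal.isClosedEmbedding.isClosedMap K hK.isClosed
  -- it suffices to prove an approximate inequality
  refine le_of_forall_pos_le_add fun η hη => ?_
  set δ := η / (3 * Real.pi) with hδ
  have hδ0 : 0 < δ := by positivity
  obtain ⟨χ, k, k', hχ, hk, hk'c, hk'0, hk1, hz, hχge, hχ1⟩ := exists_smooth_ramp hδ0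
  let T : ℂ → ℂ := fun ζ => slitFun K (Complex.exp ζ)
  let v : ℂ → ℝ := fun ζ => u (Complex.exp ζ)
  let G : ℂ → ℂ := fun ζ => Complex.exp ζ * h (Complex.exp ζ)
  have hkc : Continuous k := continuous_iff_continuousAt.2 fun x => (hk x).continuousAt
  have hχc : Continuous χ := continuous_iff_continuousAt.2 fun x => (hχ x).continuousAt
  have hnorm : ∀ ζ : ℂ, ζ.re ≤ 0 → ‖Complex.exp ζ‖ < R := fun ζ hζ =>
    (norm_exp_le_one hζ).trans_lt hR
  have hvd : ∀ ζ : ℂ, ζ.re ≤ 0 → (∀ t ∈ L, Complex.exp ζ ≠ t) →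
      HasFDerivAt v (reMul (G ζ)) ζ := by
    intro ζ hre hζ
    refine ((hu _ (hnorm ζ hre) hζ).comp ζ
      ((Complex.hasDerivAt_exp ζ).hasFDerivAt.restrictScalars ℝ)).congr_fderiv ?_
    ext w
    simp only [ContinuousLinearMap.comp_apply, reMul_apply, G]
    congr 1
    simp
    ring
  have hGd : ∀ ζ : ℂ, ζ.re ≤ 0 → (∀ t ∈ L, Complex.exp ζ ≠ t) → DifferentiableAt ℂ G ζ := by
    intro ζ hre hζ
    exact Complex.differentiableAt_exp.mul
      ((hh _ (hnorm ζ hre) hζ).comp ζ Complex.differentiableAt_exp)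
  have hstrip : ∀ ζ ∈ openStrip, ∀ t ∈ L, Complex.exp ζ ≠ t := by
    intro ζ hζ t _ h
    have := exp_im_pos_of_mem_openStrip hζ
    rw [h] at this
    simp at this
  have hsmall : ∀ ζ : ℂ, ζ.re ≤ 0 → ∀ t ∈ L, Complex.exp ζ = t → ∀ᶠ ξ in nhds ζ, v ξ < δ := by
    intro ζ hre t ht he
    have hu0 : v ζ = 0 := by simp only [v]; rw [he]; exact huL t ht
    have ht1 : |t| < R := by
      have := hnorm ζ hre
      rwa [he, Complex.norm_real] at this
    have hc : ContinuousAt v ζ := by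
      have h1 := huc t ht ht1
      rw [← he] at h1
      exact h1.comp Complex.continuous_exp.continuousAt
    exact hc.eventually_lt_const (by rw [hu0]; exact hδ0)
  have hnwithin : ∀ s : ℝ, ∀ ζ ∈ Set.Icc s 0 ×ℂ Set.Icc 0 Real.pi,
      (∀ t ∈ L, Complex.exp ζ ≠ t) →
      ContinuousWithinAt n (Set.Icc s 0 ×ℂ Set.Icc 0 Real.pi) ζ := by
    intro s ζ hζ hne
    refine (hnc ζ ⟨hζ.2, hζ.1.2, fun t ht => hne t (hKL ht)⟩).mono_of_mem_nhdsWithin ?_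
    have hop : ∀ᶠ ξ in nhds ζ, Complex.exp ξ ∉ Complex.ofReal '' K := by
      refine Complex.continuous_exp.continuousAt.eventually (hclosedK.isOpen_compl.mem_nhds ?_)
      rintro ⟨t, ht, e⟩
      exact hne t (hKL ht) e.symm
    filter_upwards [self_mem_nhdsWithin, mem_nhdsWithin_of_mem_nhds hop] with ξ h1 h2
    exact ⟨h1.2, h1.1.2, fun t ht e => h2 ⟨t, ht, e.symm⟩⟩
  have hTc : ∀ ζ : ℂ, ζ.re ≤ 0 → (∀ t ∈ L, Complex.exp ζ ≠ t) → ContinuousAt T ζ :=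
    fun ζ hre hne => (differentiableAt_slitFun_exp hK h0K hK1
      ⟨hre, fun t ht => hne t (hKL ht)⟩).continuousAt
  have hqc : ∀ s : ℝ, ContinuousOn (fun ζ => χ (v ζ) • T ζ + n ζ • k (v ζ) • G ζ)
      (Set.Icc s 0 ×ℂ Set.Icc 0 Real.pi) := by
    intro s ζ hζ
    by_cases hne : ∀ t ∈ L, Complex.exp ζ ≠ t
    · have hvc := (hvd ζ hζ.1.2 hne).continuousAt.continuousWithinAt
        (s := Set.Icc s 0 ×ℂ Set.Icc 0 Real.pi)
      exact ((hχc.continuousAt.comp_continuousWithinAt hvc).smul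
        (hTc ζ hζ.1.2 hne).continuousWithinAt).add ((hnwithin s ζ hζ hne).smul
        ((hkc.continuousAt.comp_continuousWithinAt hvc).smul
          (hGd ζ hζ.1.2 hne).continuousAt.continuousWithinAt))
    · push Not at hne
      obtain ⟨t, ht, he⟩ := hne
      refine ContinuousAt.continuousWithinAt (ContinuousAt.congr (f := fun _ => (0 : ℂ))
        continuousAt_const ?_)
      filter_upwards [hsmall ζ hζ.1.2 t ht he] with ξ hξ
      rw [(hz _ hξ).1, (hz _ hξ).2.1]
      simp
  have hdc : ∀ s : ℝ, ContinuousOn (fun ζ => n ζ * (k' (v ζ) * Complex.normSq (G ζ)))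
      (Set.Icc s 0 ×ℂ Set.Icc 0 Real.pi) := by
    intro s ζ hζ
    by_cases hne : ∀ t ∈ L, Complex.exp ζ ≠ t
    · have hvc := (hvd ζ hζ.1.2 hne).continuousAt.continuousWithinAt
        (s := Set.Icc s 0 ×ℂ Set.Icc 0 Real.pi)
      exact (hnwithin s ζ hζ hne).mul ((hk'c.continuousAt.comp_continuousWithinAt hvc).mul
        (Complex.continuous_normSq.continuousAt.comp_continuousWithinAt
          (hGd ζ hζ.1.2 hne).continuousAt.continuousWithinAt))
    · push Not at hne
      obtain ⟨t, ht, he⟩ := hne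
      refine ContinuousAt.continuousWithinAt (ContinuousAt.congr (f := fun _ => (0 : ℝ))
        continuousAt_const ?_)
      filter_upwards [hsmall ζ hζ.1.2 t ht he] with ξ hξ
      rw [(hz _ hξ).2.2]
      simp
  have hbot : ∀ x ≤ (0 : ℝ), ∀ y : ℝ, y = 0 ∨ y = Real.pi →
      (χ (v (x + y * I)) • T (x + y * I) + n (x + y * I) • k (v (x + y * I)) • G (x + y * I)).im
        = 0 := by
    intro x hx y hy
    have hr : ∃ r : ℝ, Complex.exp (x + y * I) = r := by
      rcases hy with rfl | rfl
      · exact ⟨Real.exp x, by simp⟩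
      · exact ⟨-Real.exp x, by rw [Complex.exp_add, Complex.exp_pi_mul_I]; simp⟩
    obtain ⟨r, hr⟩ := hr
    have hrR : |r| < R := by
      have := hnorm (x + y * I) (by simpa using hx)
      rwa [hr, Complex.norm_real] at this
    by_cases hrL : r ∈ L
    · have hv0 : v (x + y * I) = 0 := by simp only [v]; rw [hr]; exact huL r hrL
      rw [hv0, (hz 0 hδ0).1, (hz 0 hδ0).2.1]
      simp
    · have hT0 : (T (x + y * I)).im = 0 := by
        simp only [T]; rw [hr]; exact slitFun_ofReal_im K r
      have hG0 : (G (x + y * I)).im = 0 := by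
        simp only [G]; rw [hr, Complex.im_ofReal_mul, hreal r hrR hrL, mul_zero]
      simp [hT0, hG0]
  -- behaviour at the centre
  have hu0c : ContinuousAt u 0 := (hu 0 (by simp; linarith) h0L).continuousAt
  have hh0c : ContinuousAt h 0 := (hh 0 (by simp; linarith) h0L).continuousAt
  have hT0c : ContinuousAt (slitFun K) 0 :=
    (differentiableAt_slitFun hK h0K (slit_denominator_ne_zero_of_not_mem hK1 (by simp)
      fun t ht => h0L t (hKL ht))).continuousAt
  have hev1 : ∀ᶠ z in nhds (0 : ℂ), χ (u 0) - δ / 2 < χ (u z) * (slitFun K z).re := by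
    have hc : ContinuousAt (fun z => χ (u z) * (slitFun K z).re) 0 :=
      (hχc.continuousAt.comp hu0c).mul (Complex.continuous_re.continuousAt.comp hT0c)
    refine hc.eventually_const_lt ?_
    beta_reduce
    rw [slitFun_zero]
    simp
    linarith
  have hev2 : ∀ᶠ z in nhds (0 : ℂ), ‖h z‖ < ‖h 0‖ + 1 :=
    hh0c.norm.eventually_lt_const (lt_add_one _)
  obtain ⟨r, hr0, hr⟩ := Metric.eventually_nhds_iff_ball.1 (hev1.and hev2)
  have hev3 : Tendsto (fun x : ℝ => (C + M * x) * (Real.exp (-x) * (‖h 0‖ + 1))) atTop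
      (nhds 0) := by
    have t0 := Real.tendsto_pow_mul_exp_neg_atTop_nhds_zero 0
    have t1 := Real.tendsto_pow_mul_exp_neg_atTop_nhds_zero 1
    have := ((t0.const_mul C).add (t1.const_mul M)).mul_const (‖h 0‖ + 1)
    simp only [mul_zero, add_zero, zero_mul] at this
    refine this.congr fun x => ?_
    ring
  obtain ⟨x, hx1, hx2, hx3, hx4⟩ := ((hev3.eventually_lt_const (half_pos hδ0)).and
    ((Real.tendsto_exp_neg_atTop_nhds_zero.eventually_lt_const hr0).and
    ((eventually_gt_atTop (0 : ℝ)).and (eventually_ge_atTop (-s₀))))).exists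
  have hgreen := strip_green_inequality (s := -x) (by linarith)
    (fun ζ hζ => differentiableAt_slitFun_exp_openStrip hK h0K hζ)
    (fun ζ hζ hre => hGd ζ hre.le (hstrip ζ hζ)) hn
    (fun ζ hζ hre => hvd ζ hre.le (hstrip ζ hζ)) hχ hk hk'0 hnn (hqc (-x)) (hdc (-x))
    (fun y hy => hbot y hy.2)
  have hlineint : ∀ s ∈ Set.Icc (-x) 0, IntervalIntegrable (fun y : ℝ =>
      (χ (v (s + y * I)) • T (s + y * I) + n (s + y * I) • k (v (s + y * I)) • G (s + y * I)).re)
      volume 0 Real.pi := by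
    intro s hs
    apply ContinuousOn.intervalIntegrable
    rw [Set.uIcc_of_le hpi.le]
    refine Complex.continuous_re.comp_continuousOn ((hqc (-x)).comp
      (f := fun y : ℝ => (s + y * I : ℂ)) (by fun_prop) fun y hy => ?_)
    exact ⟨by simpa using hs, by simpa using hy⟩
  have hleft : ∫ y in (0 : ℝ)..Real.pi, (χ (u 0) - δ) ≤
      ∫ y in (0 : ℝ)..Real.pi, (χ (v ((-x : ℝ) + y * I)) • T ((-x : ℝ) + y * I) +
      n ((-x : ℝ) + y * I) • k (v ((-x : ℝ) + y * I)) • G ((-x : ℝ) + y * I)).re := by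
    refine intervalIntegral.integral_mono_on_of_le_Ioo hpi.le (by simp)
      (hlineint (-x) ⟨le_rfl, by linarith⟩) fun y hy => ?_
    set ζ : ℂ := (-x : ℝ) + y * I with hζ
    have hre : ζ.re = -x := by simp [hζ]
    have hmem : ζ ∈ openStrip := by simpa [hζ, openStrip] using hy
    have hnrm : ‖Complex.exp ζ‖ = Real.exp (-x) := by rw [Complex.norm_exp, hre]
    obtain ⟨h1, h2⟩ := hr (Complex.exp ζ) (by rw [mem_ball_zero_iff, hnrm]; exact hx2)
    have h3 := hnb ζ hmem (by rw [hre]; linarith)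
    rw [hre, abs_neg, abs_of_pos hx3] at h3
    have h4 : |n ζ * (k (v ζ) * (G ζ).re)| ≤
        (C + M * x) * (Real.exp (-x) * (‖h 0‖ + 1)) := by
      rw [abs_mul, abs_mul]
      have hG : |(G ζ).re| ≤ Real.exp (-x) * (‖h 0‖ + 1) := by
        refine (Complex.abs_re_le_norm _).trans ?_
        simp only [G]
        rw [norm_mul, hnrm]
        gcongr
      have hkG : |k (v ζ)| * |(G ζ).re| ≤ 1 * (Real.exp (-x) * (‖h 0‖ + 1)) :=
        mul_le_mul (hk1 _) hG (abs_nonneg _) zero_le_one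
      rw [one_mul] at hkG
      exact mul_le_mul h3 hkG (by positivity) ((abs_nonneg _).trans h3)
    have h5 := (abs_le.1 h4).1
    rw [Complex.add_re, Complex.smul_re, Complex.smul_re, Complex.smul_re]
    simp only [smul_eq_mul]
    have h1' : χ (u 0) - δ / 2 < χ (v ζ) * (T ζ).re := h1
    linarith
  have hφint : IntervalIntegrable φ volume 0 Real.pi := by
    have hc : ContinuousOn (fun y : ℝ => (slitFun K (Complex.exp (y * I))).re)
        (Set.uIcc 0 Real.pi) := by
      intro y _
      refine (Complex.continuous_re.continuousAt.comp (ContinuousAt.comp (g := T)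
        (f := fun y : ℝ => (y * I : ℂ)) ?_ (by fun_prop))).continuousWithinAt
      refine (differentiableAt_slitFun_exp hK h0K hK1 ⟨by simp, fun t ht e => ?_⟩).continuousAt
      have := congrArg norm e
      rw [Complex.norm_exp_ofReal_mul_I, Complex.norm_real, Real.norm_eq_abs] at this
      have h3 : |t| < 1 := abs_lt.2 (hK1 ht)
      linarith
    have hcφ : ContinuousOn φ (Set.uIcc 0 Real.pi) := hc.congr fun y _ => by
      beta_reduce
      rw [hexpT, Complex.ofReal_re]
    exact hcφ.intervalIntegrable
  have hright : (∫ y in (0 : ℝ)..Real.pi, (χ (v ((0 : ℝ) + y * I)) • T ((0 : ℝ) + y * I) +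
      n ((0 : ℝ) + y * I) • k (v ((0 : ℝ) + y * I)) • G ((0 : ℝ) + y * I)).re) ≤
      ∫ y in (0 : ℝ)..Real.pi, φ y := by
    refine intervalIntegral.integral_mono_on hpi.le (hlineint 0 ⟨by linarith, le_rfl⟩) hφint
      fun y hy => ?_
    rw [Complex.ofReal_zero, zero_add, hnz y hy, zero_smul, add_zero, Complex.smul_re]
    have hT : (T (y * I)).re = φ y := by simp only [T]; rw [hexpT, Complex.ofReal_re]
    rw [hT, smul_eq_mul]
    refine mul_le_of_le_one_left (Real.exp_pos _).le (hχ1 _ (hu1 _ (hnorm _ (by simp))))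
  have hfin := hleft.trans (hgreen.trans hright)
  rw [intervalIntegral.integral_const, sub_zero, smul_eq_mul] at hfin
  have h1 := hχge (u 0)
  have h2 : Real.pi * (u 0 - 3 * δ) ≤ Real.pi * (χ (u 0) - δ) :=
    mul_le_mul_of_nonneg_left (by linarith) hpi.le
  have h3 : Real.pi * (3 * δ) = η := by rw [hδ]; field_simp
  linarith

theorem HarmonicOnSet.harmonicAt {u : ℂ → ℝ} {U : Set ℂ} (hU : IsOpen U) (hu : HarmonicOnSet u U)
    {z : ℂ} (hz : z ∈ U) : InnerProductSpace.HarmonicAt u z := by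
  refine ⟨hu.1.contDiffAt (hU.mem_nhds hz), ?_⟩
  filter_upwards [hU.mem_nhds hz] with w hw
  have hd : DifferentiableAt ℝ (fderiv ℝ u) w :=
    ((hu.1.contDiffAt (hU.mem_nhds hw)).fderiv_right (m := 1) (by norm_num)).differentiableAt
      one_ne_zero
  have h := hu.2 w hw
  unfold planarLaplacian at h
  rw [fderiv_clm_apply hd (by fun_prop), fderiv_clm_apply hd (by fun_prop)] at h
  simp only [InnerProductSpace.laplacian_eq_iteratedFDeriv_complexPlane, iteratedFDeriv_two_apply]
  simpa using h

/-- The complex gradient of a real function, holomorphic where the function is harmonic. -/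
noncomputable def complexGradient (u : ℂ → ℝ) (z : ℂ) : ℂ := fderiv ℝ u z 1 - I * fderiv ℝ u z I

theorem hasFDerivAt_reMul_complexGradient {u : ℂ → ℝ} {z : ℂ} (hu : DifferentiableAt ℝ u z) :
    HasFDerivAt u (reMul (complexGradient u z)) z := by
  refine hu.hasFDerivAt.congr_fderiv ?_
  ext v
  have hv : v = v.re • (1 : ℂ) + v.im • I := by simp
  conv_lhs => rw [hv]
  rw [map_add, map_smul, map_smul, reMul_apply, complexGradient]
  simp
  ring

theorem pi_mul_one_sub_le {K : Set ℝ} (hK : IsClosed K)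
    (h0 : (0 : ℝ) ∉ K) {ω : ℂ → ℝ}
    (hω : IsHarmonicMeasureFn ω (Metric.ball (0 : ℂ) 1) (Complex.ofReal '' K))
    {ρ : ℝ} (hρ0 : 0 < ρ) (hρ1 : ρ < 1) :
    Real.pi * (1 - ω 0) ≤ ∫ τ in (0 : ℝ)..Real.pi,
      Real.exp (-(∫ t in {t : ℝ | ρ * t ∈ K} ∩ Set.Icc (-ρ) ρ, poissonCos t (Real.cos τ)) / 2) := by
  classical
  obtain ⟨hharm, hbd, hone, -⟩ := hω
  set U : Set ℂ := Metric.ball (0 : ℂ) 1 \ Complex.ofReal '' K with hUdef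
  have hclosed : IsClosed (Complex.ofReal '' K) :=
    Complex.isometry_ofReal.isClosedEmbedding.isClosedMap K hK
  have hU : IsOpen U := isOpen_ball.sdiff hclosed
  set L : Set ℝ := {t : ℝ | ρ * t ∈ K} with hL
  have hLc : IsClosed L := hK.preimage (by fun_prop)
  have hLclosed : IsClosed (Complex.ofReal '' L) :=
    Complex.isometry_ofReal.isClosedEmbedding.isClosedMap L hLc
  have h0L : (0 : ℝ) ∉ L := by simpa [hL] using h0
  set c : ℂ → ℂ := fun z => (starRingEnd ℂ) z with hc
  have hscale : ∀ z : ℂ, ‖z‖ < ρ⁻¹ → z ∉ Complex.ofReal '' L → ρ * z ∈ U := by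
    intro z hz hzL
    refine ⟨?_, ?_⟩
    · rw [mem_ball_zero_iff, norm_mul, Complex.norm_real, Real.norm_of_nonneg hρ0.le]
      calc ρ * ‖z‖ < ρ * ρ⁻¹ := by gcongr
        _ = 1 := mul_inv_cancel₀ hρ0.ne'
    · rintro ⟨x, hx, e⟩
      refine hzL ⟨x / ρ, ?_, ?_⟩
      · show ρ * (x / ρ) ∈ K
        rwa [mul_div_cancel₀ _ hρ0.ne']
      · have : (ρ : ℂ) ≠ 0 := by exact_mod_cast hρ0.ne'
        rw [Complex.ofReal_div, e]
        field_simp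
  have hcn : ∀ z : ℂ, ‖z‖ < ρ⁻¹ → ‖c z‖ < ρ⁻¹ := fun z hz => by rwa [hc, Complex.norm_conj]
  have hcL : ∀ z : ℂ, z ∉ Complex.ofReal '' L → c z ∉ Complex.ofReal '' L := by
    rintro z hz ⟨x, hx, e⟩
    refine hz ⟨x, hx, ?_⟩
    have := congrArg (starRingEnd ℂ) e
    simpa [hc] using this
  have hnot : ∀ z : ℂ, (∀ t ∈ L, z ≠ t) → z ∉ Complex.ofReal '' L := by
    rintro z hz ⟨x, hx, e⟩
    exact hz x hx e.symm
  set u : ℂ → ℝ := fun z => if z ∈ Complex.ofReal '' L then 0 else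
    1 - (ω (ρ * z) + ω (ρ * c z)) / 2 with hu
  set g := complexGradient ω with hg
  set h : ℂ → ℂ := fun z => -(ρ / 2) * (g (ρ * z) + c (g (ρ * c z))) with hh
  have hωd : ∀ w ∈ U, HasFDerivAt ω (reMul (g w)) w := fun w hw =>
    hasFDerivAt_reMul_complexGradient
      ((hharm.1.contDiffAt (hU.mem_nhds hw)).differentiableAt two_ne_zero)
  have hgd : ∀ w ∈ U, DifferentiableAt ℂ g w := fun w hw =>
    HarmonicAt.differentiableAt_complex_partial (hharm.harmonicAt hU hw)
  have huoff : ∀ z, z ∉ Complex.ofReal '' L → u z = 1 - (ω (ρ * z) + ω (ρ * c z)) / 2 :=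
    fun z hz => if_neg hz
  have hmain := disc_value_le (K := L ∩ Set.Icc (-ρ) ρ) (L := L) (R := ρ⁻¹) (u := u) (h := h)
    (isCompact_Icc.inter_left hLc) h0L
    (fun t ht => ⟨by linarith [ht.2.1], by linarith [ht.2.2]⟩) inter_subset_left
    ((one_lt_inv₀ hρ0).2 hρ1) ?_ ?_ ?_ ?_ ?_ ?_
  · have : u 0 = 1 - ω 0 := by
      rw [huoff 0 (hnot 0 fun t ht e => h0L ?_)]
      · simp [hc]
      · have : t = 0 := by exact_mod_cast e.symm
        exact this ▸ ht
    rwa [this] at hmain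
  · intro z hz hzL
    have hz' := hnot z hzL
    have d1 := (hωd _ (hscale z hz hz')).comp z
      (((hasDerivAt_id' z).const_mul (ρ : ℂ)).hasFDerivAt.restrictScalars ℝ)
    have d2 := (hωd _ (hscale (c z) (hcn z hz) (hcL z hz'))).comp z
      ((((hasDerivAt_id' (c z)).const_mul (ρ : ℂ)).hasFDerivAt.restrictScalars ℝ).comp z
        Complex.conjCLE.toContinuousLinearMap.hasFDerivAt)
    refine HasFDerivAt.congr_of_eventuallyEq (((d1.add d2).const_mul (-(1 / 2 : ℝ))).const_add 1
      |>.congr_fderiv ?_) ?_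
    · ext v
      simp [reMul_apply, hh, hc]
      ring
    · filter_upwards [hLclosed.isOpen_compl.mem_nhds hz'] with w hw
      rw [huoff w hw]
      simp [hc]
      ring
  · intro z hz hzL
    have hz' := hnot z hzL
    have d1 : DifferentiableAt ℂ (fun w => g (ρ * w)) z :=
      (hgd _ (hscale z hz hz')).comp z (by fun_prop)
    have d2 : DifferentiableAt ℂ (fun w => g (ρ * w)) (c z) :=
      (hgd _ (hscale (c z) (hcn z hz) (hcL z hz'))).comp (c z) (by fun_prop)
    have d3 : DifferentiableAt ℂ (fun w => c (g (ρ * c w))) z := by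
      have := d2.conj_conj
      rw [hc, Complex.conj_conj] at this
      exact this
    exact (d1.add d3).const_mul _
  · intro x hx hxL
    simp [hh, hc]
  · intro t ht
    exact if_pos ⟨t, ht, rfl⟩
  · intro t ht htR
    have hut : u t = 0 := if_pos ⟨t, ht, rfl⟩
    have htU : (ρ * t : ℂ) ∈ Complex.ofReal '' K ∩ Metric.ball 0 1 := by
      refine ⟨⟨ρ * t, ht, by simp⟩, ?_⟩
      rw [mem_ball_zero_iff, norm_mul, Complex.norm_real, Complex.norm_real,
        Real.norm_of_nonneg hρ0.le, Real.norm_eq_abs]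
      calc ρ * |t| < ρ * ρ⁻¹ := by gcongr
        _ = 1 := mul_inv_cancel₀ hρ0.ne'
    have hlim := hone _ htU
    rw [ContinuousAt, hut, Metric.tendsto_nhds]
    intro ε hε
    have hev := eventually_nhdsWithin_iff.1 ((Metric.tendsto_nhds.1 hlim) ε hε)
    have e1 : ∀ᶠ z : ℂ in nhds (t : ℂ), (ρ * z ∈ U → dist (ω (ρ * z)) 1 < ε) :=
      (ContinuousAt.tendsto (f := fun z : ℂ => (ρ * z : ℂ)) (x := (t : ℂ))
        (by fun_prop)).eventually hev
    have e2 : ∀ᶠ z : ℂ in nhds (t : ℂ), (ρ * c z ∈ U → dist (ω (ρ * c z)) 1 < ε) := by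
      have hcont : Tendsto (fun z : ℂ => (ρ * c z : ℂ)) (nhds (t : ℂ)) (nhds (ρ * t)) := by
        have : Continuous fun z : ℂ => (ρ * c z : ℂ) := by
          simp only [hc]; exact continuous_const.mul Complex.continuous_conj
        have h2 := this.tendsto (t : ℂ)
        simpa [hc] using h2
      exact hcont.eventually hev
    have e3 : ∀ᶠ z : ℂ in nhds (t : ℂ), ‖z‖ < ρ⁻¹ :=
      continuous_norm.continuousAt.eventually_lt_const (by simpa using htR)
    filter_upwards [e1, e2, e3] with z h1 h2 h3
    by_cases hzL : z ∈ Complex.ofReal '' L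
    · have : u z = 0 := if_pos hzL
      rw [this]
      simpa using hε
    · rw [huoff z hzL]
      have h1 := h1 (hscale z h3 hzL)
      have h2 := h2 (hscale (c z) (hcn z h3) (hcL z hzL))
      rw [Real.dist_eq, abs_lt] at *
      constructor <;> linarith [h1.1, h1.2, h2.1, h2.2]
  · intro z hz
    by_cases hzL : z ∈ Complex.ofReal '' L
    · have : u z = 0 := if_pos hzL
      rw [this]
      exact zero_le_one
    · rw [huoff z hzL]
      have h1 := (hbd _ (hscale z hz hzL)).1
      have h2 := (hbd _ (hscale (c z) (hcn z hz) (hcL z hzL))).1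
      linarith

theorem poissonCos_denominator_pos {t c : ℝ} (ht : |t| < 1) (hc : |c| ≤ 1) :
    0 < 1 + t ^ 2 - 2 * t * c := by
  have h1 : t * c ≤ |t| := by
    calc t * c ≤ |t * c| := le_abs_self _
      _ = |t| * |c| := abs_mul _ _
      _ ≤ |t| := mul_le_of_le_one_right (abs_nonneg _) hc
  have h2 : 0 < (1 - |t|) ^ 2 := by have : 0 < 1 - |t| := by linarith
                                    positivity
  nlinarith [sq_abs t]

theorem poissonCos_denominator_pos' {t c : ℝ} (hc : |c| < 1) :
    0 < 1 + t ^ 2 - 2 * t * c := by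
  have h2 : c ^ 2 < 1 := by rw [← sq_abs]; nlinarith [abs_nonneg c]
  nlinarith [sq_nonneg (t - c)]

theorem poissonCos_nonneg {t c : ℝ} (ht : |t| ≤ 1) (hc : |c| ≤ 1) : 0 ≤ poissonCos t c := by
  unfold poissonCos
  have h1 : t * c ≤ |t| := by
    calc t * c ≤ |t * c| := le_abs_self _
      _ = |t| * |c| := abs_mul _ _
      _ ≤ |t| := mul_le_of_le_one_right (abs_nonneg _) hc
  have h2 : 0 ≤ 1 - t ^ 2 := by rw [← sq_abs]; nlinarith [abs_nonneg t]
  have h3 : 0 ≤ 1 + t ^ 2 - 2 * t * c := by nlinarith [sq_abs t, sq_nonneg (1 - |t|)]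
  positivity

theorem poissonCos_neg (t c : ℝ) : poissonCos (-t) c = poissonCos t (-c) := by
  unfold poissonCos
  rw [abs_neg]
  congr 2 <;> ring

theorem continuous_poissonCos_cos {t : ℝ} (ht0 : t ≠ 0) (ht : |t| < 1) :
    Continuous fun τ : ℝ => poissonCos t (Real.cos τ) := by
  unfold poissonCos
  refine Continuous.div (by fun_prop) (by fun_prop) fun τ => ?_
  exact mul_ne_zero (abs_ne_zero.2 ht0)
    (poissonCos_denominator_pos ht (Real.abs_cos_le_one τ)).ne'

theorem integral_poissonCos {t : ℝ} (ht0 : 0 < t) (ht : t < 1) :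
    ∫ τ in (0 : ℝ)..Real.pi, poissonCos t (Real.cos τ) = Real.pi / t := by
  have hpos : ∀ τ : ℝ, 0 < 1 - t * Real.cos τ := fun τ => by
    nlinarith [Real.cos_le_one τ, Real.neg_one_le_cos τ]
  have hden : ∀ τ : ℝ, 0 < 1 + t ^ 2 - 2 * t * Real.cos τ := fun τ =>
    poissonCos_denominator_pos (by rwa [abs_of_pos ht0]) (Real.abs_cos_le_one τ)
  have hd : ∀ τ : ℝ, HasDerivAt (fun τ : ℝ =>
      (τ + 2 * Real.arctan (t * Real.sin τ / (1 - t * Real.cos τ))) / t)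
      (poissonCos t (Real.cos τ)) τ := by
    intro τ
    have h1 : HasDerivAt (fun τ : ℝ => t * Real.sin τ / (1 - t * Real.cos τ)) _ τ :=
      ((Real.hasDerivAt_sin τ).const_mul t).fun_div
        (((Real.hasDerivAt_cos τ).const_mul t).const_sub 1) (hpos τ).ne'
    refine (((hasDerivAt_id' τ).fun_add (h1.arctan.const_mul 2)).div_const t).congr_deriv ?_
    unfold poissonCos
    have := hpos τ
    have h3 := hden τ
    rw [abs_of_pos ht0]
    have h2 : 1 + (t * Real.sin τ / (1 - t * Real.cos τ)) ^ 2 =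
        (1 + t ^ 2 - 2 * t * Real.cos τ) / (1 - t * Real.cos τ) ^ 2 := by
      field_simp
      have := Real.sin_sq_add_cos_sq τ
      linear_combination t ^ 2 * this
    rw [h2]
    field_simp
    have := Real.sin_sq_add_cos_sq τ
    linear_combination (-2 * t ^ 2) * this
  rw [intervalIntegral.integral_eq_sub_of_hasDerivAt (fun τ _ => hd τ)
    ((continuous_poissonCos_cos ht0.ne' (by rwa [abs_of_pos ht0])).intervalIntegrable _ _)]
  simp

theorem integral_one_add_cos_mul_poissonCos {t : ℝ} (ht0 : 0 < t) (ht : t < 1) :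
    ∫ τ in (0 : ℝ)..Real.pi, (1 + Real.cos τ) * poissonCos t (Real.cos τ) =
      Real.pi / t + Real.pi := by
  have hden : ∀ τ : ℝ, 0 < 1 + t ^ 2 - 2 * t * Real.cos τ := fun τ =>
    poissonCos_denominator_pos (by rwa [abs_of_pos ht0]) (Real.abs_cos_le_one τ)
  have h1 : ∀ τ : ℝ, (1 + Real.cos τ) * poissonCos t (Real.cos τ) =
      (1 + (1 + t ^ 2) / (2 * t)) * poissonCos t (Real.cos τ) - (1 - t ^ 2) / (2 * t ^ 2) := by
    intro τ
    have := (hden τ).ne'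
    unfold poissonCos
    rw [abs_of_pos ht0]
    have h2 : (1 - t ^ 2) / (t * (1 + t ^ 2 - 2 * t * Real.cos τ)) *
        (1 + t ^ 2 - 2 * t * Real.cos τ) = (1 - t ^ 2) / t := by
      rw [div_mul_eq_mul_div, mul_div_mul_right _ _ this]
    have h3 : (1 - t ^ 2) / t / (2 * t) = (1 - t ^ 2) / (2 * t ^ 2) := by field_simp
    have h4 : 1 + Real.cos τ = 1 + (1 + t ^ 2) / (2 * t) -
        (1 + t ^ 2 - 2 * t * Real.cos τ) / (2 * t) := by field_simp; ring
    rw [← h3, ← h2, h4]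
    ring
  simp only [h1]
  rw [intervalIntegral.integral_sub, intervalIntegral.integral_const_mul,
    integral_poissonCos ht0 ht, intervalIntegral.integral_const]
  · simp
    field_simp
    ring
  · exact ((continuous_poissonCos_cos ht0.ne'
      (by rwa [abs_of_pos ht0])).intervalIntegrable _ _).const_mul _
  · simp

theorem integral_mul_poissonCos_antitone {w : ℝ → ℝ} (hw : ContinuousOn w (Set.Icc (-1) 1))
    (hw0 : ∀ c ∈ Set.Icc (-1 : ℝ) 1, 0 ≤ w c)
    (hwa : AntitoneOn (fun c => w c / (1 + c)) (Set.Ioo (-1) 1)) :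
    AntitoneOn (fun t => ∫ τ in (0 : ℝ)..Real.pi, w (Real.cos τ) * poissonCos t (Real.cos τ))
      (Set.Ioo 0 1) := by
  intro t ht t' ht' htt
  beta_reduce
  rcases htt.eq_or_lt with rfl | htt
  · exact le_rfl
  obtain ⟨ht0, ht1⟩ := ht
  obtain ⟨ht'0, ht'1⟩ := ht'
  have hat : |t| < 1 := by rwa [abs_of_pos ht0]
  have hat' : |t'| < 1 := by rwa [abs_of_pos ht'0]
  have hwc : Continuous fun τ => w (Real.cos τ) :=
    hw.comp_continuous Real.continuous_cos fun τ => ⟨Real.neg_one_le_cos τ, Real.cos_le_one τ⟩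
  have hc := continuous_poissonCos_cos ht0.ne' hat
  have hc' := continuous_poissonCos_cos ht'0.ne' hat'
  have hi : IntervalIntegrable (fun τ => w (Real.cos τ) * poissonCos t (Real.cos τ)) volume 0
      Real.pi := (hwc.mul hc).intervalIntegrable _ _
  have hi' : IntervalIntegrable (fun τ => w (Real.cos τ) * poissonCos t' (Real.cos τ)) volume 0
      Real.pi := (hwc.mul hc').intervalIntegrable _ _
  set α : ℝ := (1 - t ^ 2) * (t' * (1 + t' ^ 2)) - (1 - t' ^ 2) * (t * (1 + t ^ 2)) with hα
  set β : ℝ := 2 * (t' ^ 2 - t ^ 2) with hβ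
  have hβ0 : 0 < β := by nlinarith
  have hD : ∀ c : ℝ, |c| ≤ 1 → poissonCos t c - poissonCos t' c = (α - β * c) /
      (t * (1 + t ^ 2 - 2 * t * c) * (t' * (1 + t' ^ 2 - 2 * t' * c))) := by
    intro c hc
    have h1 := (poissonCos_denominator_pos hat hc).ne'
    have h2 := (poissonCos_denominator_pos hat' hc).ne'
    unfold poissonCos
    rw [abs_of_pos ht0, abs_of_pos ht'0, div_sub_div _ _ (mul_ne_zero ht0.ne' h1)
      (mul_ne_zero ht'0.ne' h2), hα, hβ]
    congr 1
    ring
  have hden : ∀ c : ℝ, |c| ≤ 1 →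
      0 < t * (1 + t ^ 2 - 2 * t * c) * (t' * (1 + t' ^ 2 - 2 * t' * c)) := fun c hc =>
    mul_pos (mul_pos ht0 (poissonCos_denominator_pos hat hc))
      (mul_pos ht'0 (poissonCos_denominator_pos hat' hc))
  rcases le_or_gt β α with hcase | hcase
  · refine intervalIntegral.integral_mono_on Real.pi_pos.le hi' hi fun τ _ => ?_
    have hcos := Real.abs_cos_le_one τ
    have h0 : 0 ≤ poissonCos t (Real.cos τ) - poissonCos t' (Real.cos τ) := by
      rw [hD _ hcos]
      refine div_nonneg ?_ (hden _ hcos).le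
      nlinarith [Real.cos_le_one τ]
    exact mul_le_mul_of_nonneg_left (by linarith) (hw0 _ ⟨Real.neg_one_le_cos τ, Real.cos_le_one τ⟩)
  set c₀ := α / β with hc₀
  have hβc : β * c₀ = α := mul_div_cancel₀ _ hβ0.ne'
  have hα1 : -β < α := by
    have : α + β = (t' - t) * (1 + t + t' - t * t') * (1 + t) * (1 + t') := by rw [hα, hβ]; ring
    have h2 : 0 < (t' - t) * (1 + t + t' - t * t') * (1 + t) * (1 + t') := by
      have : t * t' < 1 := by nlinarith
      have h3 : 0 < t' - t := by linarith
      have h4 : 0 < 1 + t + t' - t * t' := by linarith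
      positivity
    linarith
  have hc₀m : c₀ ∈ Set.Ioo (-1 : ℝ) 1 :=
    ⟨by rw [hc₀, lt_div_iff₀ hβ0]; linarith, by rw [hc₀, div_lt_one hβ0]; exact hcase⟩
  set κ := w c₀ / (1 + c₀) with hκ
  have hκ0 : 0 ≤ κ := div_nonneg (hw0 _ ⟨hc₀m.1.le, hc₀m.2.le⟩) (by linarith [hc₀m.1])
  have hint : ∀ s, 0 < s → s < 1 → IntervalIntegrable
      (fun τ => (1 + Real.cos τ) * poissonCos s (Real.cos τ)) volume 0 Real.pi := fun s h0 h1 =>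
    ((by fun_prop : Continuous fun τ => 1 + Real.cos τ).mul (continuous_poissonCos_cos h0.ne'
      (by rwa [abs_of_pos h0]))).intervalIntegrable _ _
  have hle : κ * ((Real.pi / t + Real.pi) - (Real.pi / t' + Real.pi)) ≤
      (∫ τ in (0 : ℝ)..Real.pi, w (Real.cos τ) * poissonCos t (Real.cos τ)) -
      ∫ τ in (0 : ℝ)..Real.pi, w (Real.cos τ) * poissonCos t' (Real.cos τ) := by
    rw [← integral_one_add_cos_mul_poissonCos ht0 ht1,
      ← integral_one_add_cos_mul_poissonCos ht'0 ht'1,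
      ← intervalIntegral.integral_sub (hint t ht0 ht1) (hint t' ht'0 ht'1),
      ← intervalIntegral.integral_const_mul, ← intervalIntegral.integral_sub hi hi']
    refine intervalIntegral.integral_mono_on_of_le_Ioo Real.pi_pos.le
      (((hint t ht0 ht1).sub (hint t' ht'0 ht'1)).const_mul _) (hi.sub hi') fun τ hτ => ?_
    have hcos := Real.abs_cos_le_one τ
    have hcm : Real.cos τ ∈ Set.Ioo (-1 : ℝ) 1 := by
      constructor
      · rw [← Real.cos_pi]
        exact Real.cos_lt_cos_of_nonneg_of_le_pi hτ.1.le le_rfl hτ.2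
      · rw [← Real.cos_zero]
        exact Real.cos_lt_cos_of_nonneg_of_le_pi le_rfl hτ.2.le hτ.1
    rw [← mul_sub, ← mul_sub, hD _ hcos]
    have h1c : 0 < 1 + Real.cos τ := by linarith [hcm.1]
    have hwq : w (Real.cos τ) = w (Real.cos τ) / (1 + Real.cos τ) * (1 + Real.cos τ) := by
      field_simp
    rw [hwq, ← mul_assoc, ← sub_nonneg, ← sub_mul, ← sub_mul]
    rw [← mul_div_assoc]
    refine div_nonneg ?_ (hden _ hcos).le
    rcases le_total (Real.cos τ) c₀ with h | h
    · have h2 := hwa hcm hc₀m h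
      have h3 : 0 ≤ α - β * Real.cos τ := by rw [← hβc]; nlinarith
      exact mul_nonneg (mul_nonneg (sub_nonneg.2 h2) h1c.le) h3
    · have h2 := hwa hc₀m hcm h
      have h3 : α - β * Real.cos τ ≤ 0 := by rw [← hβc]; nlinarith
      exact mul_nonneg_of_nonpos_of_nonpos
        (mul_nonpos_of_nonpos_of_nonneg (sub_nonpos.2 h2) h1c.le) h3
  have hpt : Real.pi / t' ≤ Real.pi / t := by have := Real.pi_pos; gcongr
  have : 0 ≤ κ * ((Real.pi / t + Real.pi) - (Real.pi / t' + Real.pi)) :=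
    mul_nonneg hκ0 (by linarith)
  linarith

theorem measurable_poissonCos : Measurable fun p : ℝ × ℝ => poissonCos p.1 p.2 := by
  unfold poissonCos
  fun_prop

theorem integrable_prod_mul_poissonCos {w : ℝ → ℝ} (hw : ContinuousOn w (Set.Icc (-1) 1))
    (hw0 : ∀ c ∈ Set.Icc (-1 : ℝ) 1, 0 ≤ w c) {a : ℝ} (ha : 0 < a) {A : Set ℝ}
    (hA : MeasurableSet A) (hAa : A ⊆ Set.Ico a 1) :
    Integrable (fun p : ℝ × ℝ => w (Real.cos p.2) * poissonCos p.1 (Real.cos p.2))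
      ((volume.restrict A).prod (volume.restrict (Set.Ioc 0 Real.pi))) := by
  have hpi := Real.pi_pos
  have hmem : ∀ τ : ℝ, Real.cos τ ∈ Set.Icc (-1 : ℝ) 1 := fun τ =>
    ⟨Real.neg_one_le_cos τ, Real.cos_le_one τ⟩
  have hwc : Continuous fun τ => w (Real.cos τ) := hw.comp_continuous Real.continuous_cos hmem
  obtain ⟨M, hM⟩ := isCompact_Icc.exists_bound_of_continuousOn hw
  have hwM : ∀ τ, w (Real.cos τ) ≤ M := fun τ => (le_abs_self _).trans (hM _ (hmem τ))
  have hM0 : 0 ≤ M := (hw0 _ (hmem 0)).trans (hwM 0)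
  have hmeas : Measurable fun p : ℝ × ℝ => w (Real.cos p.2) * poissonCos p.1 (Real.cos p.2) :=
    (hwc.measurable.comp measurable_snd).mul (measurable_poissonCos.comp
      (measurable_fst.prodMk (Real.measurable_cos.comp measurable_snd)))
  have hcont : ∀ t ∈ A, Continuous fun τ => poissonCos t (Real.cos τ) := fun t ht =>
    continuous_poissonCos_cos (ha.trans_le (hAa ht).1).ne'
      (by rw [abs_of_pos (ha.trans_le (hAa ht).1)]; exact (hAa ht).2)
  have hfin : volume A < ⊤ := (measure_mono hAa).trans_lt (by simp)
  have : IsFiniteMeasure (volume.restrict A) := ⟨by simpa using hfin⟩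
  rw [integrable_prod_iff hmeas.aestronglyMeasurable]
  refine ⟨?_, ?_⟩
  · refine (ae_restrict_iff' hA).2 (Eventually.of_forall fun t ht => ?_)
    exact (intervalIntegrable_iff_integrableOn_Ioc_of_le hpi.le).1
      ((hwc.mul (hcont t ht)).intervalIntegrable 0 Real.pi)
  · refine Integrable.of_bound hmeas.aestronglyMeasurable.norm.integral_prod_right' (M * (Real.pi / a))
      ((ae_restrict_iff' hA).2 (Eventually.of_forall fun t ht => ?_))
    obtain ⟨hta, ht1⟩ := hAa ht
    have ht0 := ha.trans_le hta
    have hP : ∀ τ, 0 ≤ poissonCos t (Real.cos τ) := fun τ =>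
      poissonCos_nonneg (by rw [abs_of_pos ht0]; exact ht1.le) (Real.abs_cos_le_one τ)
    rw [Real.norm_of_nonneg (integral_nonneg fun τ => norm_nonneg _),
      ← intervalIntegral.integral_of_le hpi.le]
    calc ∫ τ in (0 : ℝ)..Real.pi, ‖w (Real.cos τ) * poissonCos t (Real.cos τ)‖
        ≤ ∫ τ in (0 : ℝ)..Real.pi, M * poissonCos t (Real.cos τ) := by
          refine intervalIntegral.integral_mono_on hpi.le
            ((hwc.mul (hcont t ht)).norm.intervalIntegrable _ _)
            ((continuous_const.mul (hcont t ht)).intervalIntegrable _ _) fun τ _ => ?_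
          rw [Real.norm_of_nonneg (mul_nonneg (hw0 _ (hmem τ)) (hP τ))]
          exact mul_le_mul_of_nonneg_right (hwM τ) (hP τ)
      _ = M * (Real.pi / t) := by
          rw [intervalIntegral.integral_const_mul, integral_poissonCos ht0 ht1]
      _ ≤ M * (Real.pi / a) := by gcongr

theorem weighted_poissonCos_interchange {w : ℝ → ℝ} (hw : ContinuousOn w (Set.Icc (-1) 1))
    (hw0 : ∀ c ∈ Set.Icc (-1 : ℝ) 1, 0 ≤ w c) {a : ℝ} (ha : 0 < a) {A : Set ℝ}
    (hA : MeasurableSet A) (hAa : A ⊆ Set.Ico a 1) :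
    IntervalIntegrable (fun τ => w (Real.cos τ) * ∫ t in A, poissonCos t (Real.cos τ)) volume
      0 Real.pi ∧
    IntegrableOn (fun t => ∫ τ in (0 : ℝ)..Real.pi, w (Real.cos τ) * poissonCos t (Real.cos τ)) A ∧
    ∫ τ in (0 : ℝ)..Real.pi, w (Real.cos τ) * ∫ t in A, poissonCos t (Real.cos τ) =
      ∫ t in A, ∫ τ in (0 : ℝ)..Real.pi, w (Real.cos τ) * poissonCos t (Real.cos τ) := by
  have h := integrable_prod_mul_poissonCos hw hw0 ha hA hAa
  have hpi := Real.pi_pos.le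
  refine ⟨?_, ?_, ?_⟩
  · rw [intervalIntegrable_iff_integrableOn_Ioc_of_le hpi]
    refine h.integral_prod_right.congr (Eventually.of_forall fun τ => ?_)
    simp only [integral_const_mul]
  · simp only [intervalIntegral.integral_of_le hpi]
    exact h.integral_prod_left
  · simp only [intervalIntegral.integral_of_le hpi]
    rw [integral_integral_swap (f := fun t τ => w (Real.cos τ) * poissonCos t (Real.cos τ)) h]
    exact integral_congr_ae (Eventually.of_forall fun τ => (integral_const_mul (L := ℝ) _ _).symm)

theorem setIntegral_Ioo_le_of_antitoneOn {h : ℝ → ℝ} (hh : AntitoneOn h (Set.Ioo 0 1)) {r : ℝ}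
    (hr0 : 0 < r) (hr1 : r ≤ 1) {A : Set ℝ} (hA : MeasurableSet A) (hA1 : A ⊆ Set.Ioo 0 1)
    (hvol : volume A = ENNReal.ofReal (1 - r)) (hi : IntegrableOn h A)
    (hi' : IntegrableOn h (Set.Ioo r 1)) : ∫ t in Set.Ioo r 1, h t ≤ ∫ t in A, h t := by
  rcases hr1.eq_or_lt with rfl | hr1
  · have : volume A = 0 := by simpa using hvol
    rw [setIntegral_measure_zero _ this]
    simp
  have hfinA : volume A ≠ ⊤ := by rw [hvol]; exact ENNReal.ofReal_ne_top
  have hcA : IntegrableOn (fun _ => h r) A := integrableOn_const hfinA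
  have hcB : IntegrableOn (fun _ => h r) (Set.Ioo r 1) := integrableOn_const (by simp)
  have e1 : ∫ t in A, (h t - h r) = (∫ t in A, h t) - (1 - r) * h r := by
    rw [integral_sub hi hcA, setIntegral_const, Measure.real, hvol,
      ENNReal.toReal_ofReal (by linarith), smul_eq_mul]
  have e2 : ∫ t in Set.Ioo r 1, (h t - h r) = (∫ t in Set.Ioo r 1, h t) - (1 - r) * h r := by
    rw [integral_sub hi' hcB, setIntegral_const, Measure.real, Real.volume_Ioo,
      ENNReal.toReal_ofReal (by linarith), smul_eq_mul]
  have e3 : ∫ t in Set.Ioo r 1, (h t - h r) ≤ ∫ t in A, (h t - h r) := by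
    rw [← integral_indicator hA, ← integral_indicator measurableSet_Ioo]
    refine integral_mono ((integrable_indicator_iff measurableSet_Ioo).2 (hi'.sub hcB))
      ((integrable_indicator_iff hA).2 (hi.sub hcA)) fun t => ?_
    have hrm : r ∈ Set.Ioo (0 : ℝ) 1 := ⟨hr0, hr1⟩
    by_cases h1 : t ∈ A <;> by_cases h2 : t ∈ Set.Ioo r 1
    · rw [indicator_of_mem h1, indicator_of_mem h2]
    · rw [indicator_of_mem h1, indicator_of_notMem h2]
      have htr : t ≤ r := by
        by_contra! hlt
        exact h2 ⟨hlt, (hA1 h1).2⟩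
      exact sub_nonneg.2 (hh (hA1 h1) hrm htr)
    · rw [indicator_of_notMem h1, indicator_of_mem h2]
      exact sub_nonpos.2 (hh hrm ⟨hr0.trans h2.1, h2.2⟩ h2.1.le)
    · rw [indicator_of_notMem h1, indicator_of_notMem h2]
  linarith

theorem integral_mul_setIntegral_poissonCos_ge {w : ℝ → ℝ} (hw : ContinuousOn w (Set.Icc (-1) 1))
    (hw0 : ∀ c ∈ Set.Icc (-1 : ℝ) 1, 0 ≤ w c)
    (hwa : AntitoneOn (fun c => w c / (1 + c)) (Set.Ioo (-1) 1)) {a : ℝ} (ha : 0 < a)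
    {A : Set ℝ} (hA : MeasurableSet A) (hAa : A ⊆ Set.Ico a 1) {r : ℝ} (hr0 : 0 < r) (hr1 : r ≤ 1)
    (hvol : volume A = ENNReal.ofReal (1 - r)) :
    ∫ τ in (0 : ℝ)..Real.pi, w (Real.cos τ) * ∫ t in Set.Ioo r 1, poissonCos t (Real.cos τ) ≤
      ∫ τ in (0 : ℝ)..Real.pi, w (Real.cos τ) * ∫ t in A, poissonCos t (Real.cos τ) := by
  obtain ⟨-, hi, he⟩ := weighted_poissonCos_interchange hw hw0 ha hA hAa
  obtain ⟨-, hi', he'⟩ := weighted_poissonCos_interchange hw hw0 hr0 measurableSet_Ioo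
    (Set.Ioo_subset_Ico_self (a := r) (b := 1))
  rw [he, he']
  exact setIntegral_Ioo_le_of_antitoneOn (integral_mul_poissonCos_antitone hw hw0 hwa) hr0 hr1 hA
    (fun t ht => ⟨ha.trans_le (hAa ht).1, (hAa ht).2⟩) hvol hi hi'

/-- The boundary values of `slitFun K` on the unit circle, as a function of the real part. -/
noncomputable def slitWeight (K : Set ℝ) (c : ℝ) : ℝ :=
  Real.exp (-(∫ t in K, poissonCos t c) / 2)

theorem slitWeight_pos (K : Set ℝ) (c : ℝ) : 0 < slitWeight K c := Real.exp_pos _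

theorem continuousOn_slitWeight {K : Set ℝ} (hK : IsCompact K) (h0 : (0 : ℝ) ∉ K)
    (hK1 : K ⊆ Set.Ioo (-1) 1) : ContinuousOn (slitWeight K) (Set.Icc (-1) 1) := by
  have hc : Continuous fun y : ℝ => (slitFun K (Complex.exp (y * I))).re := by
    refine continuous_iff_continuousAt.2 fun y => ?_
    refine Complex.continuous_re.continuousAt.comp (ContinuousAt.comp
      (g := fun ζ => slitFun K (Complex.exp ζ)) (f := fun y : ℝ => (y * I : ℂ)) ?_ (by fun_prop))
    refine (differentiableAt_slitFun_exp hK h0 hK1 ⟨by simp, fun t ht e => ?_⟩).continuousAt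
    have := congrArg norm e
    rw [Complex.norm_exp_ofReal_mul_I, Complex.norm_real, Real.norm_eq_abs] at this
    have h3 : |t| < 1 := abs_lt.2 (hK1 ht)
    linarith
  refine (hc.comp Real.continuous_arccos).continuousOn.congr fun c hc => ?_
  rw [Function.comp_apply, slitFun_circle K _ (Complex.norm_exp_ofReal_mul_I _),
    Complex.exp_ofReal_mul_I_re, Real.cos_arccos hc.1 hc.2, Complex.ofReal_re, slitWeight]

theorem integrableOn_poissonCos {K : Set ℝ} (hK : IsCompact K) (h0 : (0 : ℝ) ∉ K)
    (hK1 : K ⊆ Set.Ioo (-1) 1) {c : ℝ} (hc : |c| ≤ 1) :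
    IntegrableOn (fun t => poissonCos t c) K := by
  refine ContinuousOn.integrableOn_compact hK ?_
  unfold poissonCos
  refine ContinuousOn.div (by fun_prop) (by fun_prop) fun t ht => ?_
  exact mul_ne_zero (abs_ne_zero.2 fun e => h0 (e ▸ ht))
    (poissonCos_denominator_pos (abs_lt.2 (hK1 ht)) hc).ne'

theorem integral_poissonCos_sub_le {K : Set ℝ} (hK : IsCompact K) (h0 : (0 : ℝ) ∉ K)
    (hK1 : K ⊆ Set.Ioo (-1) 1) {c₁ c₂ : ℝ} (h1 : -1 < c₁) (h12 : c₁ ≤ c₂) (h2 : c₂ < 1) :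
    (∫ t in K, poissonCos t c₁) - ∫ t in K, poissonCos t c₂ ≤
      Real.log (1 + c₂) - Real.log (1 + c₁) := by
  have ha1 : |c₁| < 1 := abs_lt.2 ⟨h1, by linarith⟩
  have ha2 : |c₂| < 1 := abs_lt.2 ⟨by linarith, h2⟩
  have d1 : ∀ t : ℝ, 0 < 1 + t ^ 2 - 2 * t * c₁ := fun t => poissonCos_denominator_pos' ha1
  have d2 : ∀ t : ℝ, 0 < 1 + t ^ 2 - 2 * t * c₂ := fun t => poissonCos_denominator_pos' ha2
  set F : ℝ → ℝ := fun t => (2 * t - 2 * c₁) / (1 + t ^ 2 - 2 * t * c₁) -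
    (2 * t - 2 * c₂) / (1 + t ^ 2 - 2 * t * c₂) with hF
  have hFc : Continuous F := by
    refine Continuous.sub (Continuous.div (by fun_prop) (by fun_prop) fun t => (d1 t).ne')
      (Continuous.div (by fun_prop) (by fun_prop) fun t => (d2 t).ne')
  have hG : ∀ t : ℝ, HasDerivAt (fun t : ℝ => Real.log (1 + t ^ 2 - 2 * t * c₁) -
      Real.log (1 + t ^ 2 - 2 * t * c₂)) (F t) t := by
    intro t
    have hd : ∀ c : ℝ, HasDerivAt (fun t : ℝ => 1 + t ^ 2 - 2 * t * c) (2 * t - 2 * c) t := by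
      intro c
      refine ((((hasDerivAt_id' t).fun_pow 2).const_add 1).fun_sub
        (((hasDerivAt_id' t).const_mul 2).mul_const c)).congr_deriv ?_
      simp
    exact ((hd c₁).log (d1 t).ne').fun_sub ((hd c₂).log (d2 t).ne')
  have hFint : ∫ t in Set.Ioc (-1 : ℝ) 0, F t = Real.log (1 + c₂) - Real.log (1 + c₁) := by
    rw [← intervalIntegral.integral_of_le (by norm_num),
      intervalIntegral.integral_eq_sub_of_hasDerivAt (fun t _ => hG t)
        (hFc.intervalIntegrable _ _)]
    have e : ∀ c : ℝ, (1 : ℝ) + (-1) ^ 2 - 2 * (-1) * c = 2 * (1 + c) := fun c => by ring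
    rw [e, e, Real.log_mul two_ne_zero (by linarith), Real.log_mul two_ne_zero (by linarith)]
    simp
  have hi1 := integrableOn_poissonCos hK h0 hK1 ha1.le
  have hi2 := integrableOn_poissonCos hK h0 hK1 ha2.le
  have hKm := hK.isClosed.measurableSet
  have hdiff : ∀ t : ℝ, |t| < 1 → poissonCos t c₁ - poissonCos t c₂ =
      2 * t * (c₁ - c₂) * (1 - t ^ 2) /
        (|t| * ((1 + t ^ 2 - 2 * t * c₁) * (1 + t ^ 2 - 2 * t * c₂))) := by
    intro t ht
    have := (d1 t).ne'
    have := (d2 t).ne'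
    unfold poissonCos
    rcases eq_or_ne t 0 with rfl | ht0
    · simp
    have := abs_ne_zero.2 ht0
    rw [div_sub_div _ _ (mul_ne_zero this (d1 t).ne') (mul_ne_zero this (d2 t).ne'),
      div_eq_div_iff (mul_ne_zero (mul_ne_zero this (d1 t).ne') (mul_ne_zero this (d2 t).ne'))
        (mul_ne_zero this (mul_ne_zero (d1 t).ne' (d2 t).ne'))]
    ring
  have hFeq : ∀ t : ℝ, F t = 2 * (c₂ - c₁) * (1 - t ^ 2) /
      ((1 + t ^ 2 - 2 * t * c₁) * (1 + t ^ 2 - 2 * t * c₂)) := by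
    intro t
    simp only [hF]
    rw [div_sub_div _ _ (d1 t).ne' (d2 t).ne']
    congr 1
    ring
  rw [← hFint, ← integral_sub hi1 hi2, ← integral_indicator hKm,
    ← integral_indicator measurableSet_Ioc]
  refine integral_mono ((integrable_indicator_iff hKm).2 (hi1.sub hi2))
    ((integrable_indicator_iff measurableSet_Ioc).2
      ((hFc.integrableOn_Icc (a := -1) (b := 0)).mono_set Set.Ioc_subset_Icc_self)) fun t => ?_
  have hF0 : ∀ t ∈ Set.Ioc (-1 : ℝ) 0, 0 ≤ F t := by
    intro t ht
    rw [hFeq]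
    have : 0 ≤ 1 - t ^ 2 := by nlinarith [ht.1, ht.2]
    have := d1 t
    have := d2 t
    have : 0 ≤ c₂ - c₁ := by linarith
    positivity
  have hFi : 0 ≤ (Set.Ioc (-1 : ℝ) 0).indicator F t := Set.indicator_apply_nonneg (hF0 t)
  by_cases htK : t ∈ K
  · have hta := abs_lt.2 (hK1 htK)
    rw [indicator_of_mem htK, hdiff t hta]
    rcases lt_trichotomy t 0 with h | h | h
    · rw [indicator_of_mem (show t ∈ Set.Ioc (-1 : ℝ) 0 from ⟨(hK1 htK).1, h.le⟩), hFeq, abs_of_neg h]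
      apply le_of_eq
      have : -t ≠ 0 := neg_ne_zero.2 h.ne
      rw [show 2 * t * (c₁ - c₂) * (1 - t ^ 2) = -t * (2 * (c₂ - c₁) * (1 - t ^ 2)) by ring,
        mul_div_mul_left _ _ this]
    · exact absurd (h ▸ htK) h0
    · refine le_trans (div_nonpos_of_nonpos_of_nonneg ?_ ?_) hFi
      · have h3 : 0 ≤ 1 - t ^ 2 := by nlinarith [(hK1 htK).2]
        have : 0 ≤ 2 * t * (c₂ - c₁) * (1 - t ^ 2) := by
          have : 0 ≤ c₂ - c₁ := by linarith
          positivity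
        linarith
      · exact mul_nonneg (abs_nonneg _) (mul_pos (d1 t) (d2 t)).le
  · rw [indicator_of_notMem htK]
    exact hFi

theorem antitoneOn_slitWeight_div {K : Set ℝ} (hK : IsCompact K) (h0 : (0 : ℝ) ∉ K)
    (hK1 : K ⊆ Set.Ioo (-1) 1) :
    AntitoneOn (fun c => slitWeight K c / (1 + c)) (Set.Ioo (-1) 1) := by
  intro c₁ h1 c₂ h2 h12
  have h := integral_poissonCos_sub_le hK h0 hK1 h1.1 h12 h2.2
  have hp1 : 0 < 1 + c₁ := by linarith [h1.1]
  have hp2 : 0 < 1 + c₂ := by linarith [h2.1]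
  beta_reduce
  rw [div_le_div_iff₀ hp2 hp1]
  have hl : Real.log (1 + c₁) ≤ Real.log (1 + c₂) := Real.log_le_log hp1 (by linarith)
  have e1 : slitWeight K c₂ * (1 + c₁) =
      Real.exp (-(∫ t in K, poissonCos t c₂) / 2 + Real.log (1 + c₁)) := by
    rw [Real.exp_add, Real.exp_log hp1, slitWeight]
  have e2 : slitWeight K c₁ * (1 + c₂) =
      Real.exp (-(∫ t in K, poissonCos t c₁) / 2 + Real.log (1 + c₂)) := by
    rw [Real.exp_add, Real.exp_log hp2, slitWeight]
  rw [e1, e2]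
  exact Real.exp_le_exp.2 (by linarith)

theorem setIntegral_neg_preimage_poissonCos (s : Set ℝ) (c : ℝ) :
    ∫ t in (fun t : ℝ => -t) ⁻¹' s, poissonCos t c = ∫ t in s, poissonCos t (-c) := by
  rw [← (Measure.measurePreserving_neg (volume : Measure ℝ)).setIntegral_preimage_emb
    (MeasurableEquiv.neg ℝ).measurableEmbedding (fun t => poissonCos t (-c)) s]
  refine integral_congr_ae (Eventually.of_forall fun t => ?_)
  beta_reduce
  rw [poissonCos_neg, neg_neg]

theorem exp_neg_setIntegral_Ioo_poissonCos {r c : ℝ} (hr0 : 0 < r) (hr1 : r ≤ 1) (hc : |c| < 1) :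
    Real.exp (-∫ t in Set.Ioo r 1, poissonCos t c) = (2 - 2 * c) / (r + 1 / r - 2 * c) := by
  have d : ∀ t : ℝ, 0 < 1 + t ^ 2 - 2 * t * c := fun t => poissonCos_denominator_pos' hc
  have hpos : ∀ t ∈ Set.uIcc r 1, 0 < t := fun t ht => by
    rw [Set.uIcc_of_le hr1] at ht
    exact hr0.trans_le ht.1
  have hder : ∀ t ∈ Set.uIcc r 1, HasDerivAt
      (fun t : ℝ => Real.log t - Real.log (1 + t ^ 2 - 2 * t * c)) (poissonCos t c) t := by
    intro t ht
    have ht0 := hpos t ht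
    have hd : HasDerivAt (fun t : ℝ => 1 + t ^ 2 - 2 * t * c) (2 * t - 2 * c) t := by
      refine ((((hasDerivAt_id' t).fun_pow 2).const_add 1).fun_sub
        (((hasDerivAt_id' t).const_mul 2).mul_const c)).congr_deriv ?_
      simp
    refine ((Real.hasDerivAt_log ht0.ne').fun_sub (hd.log (d t).ne')).congr_deriv ?_
    rw [poissonCos, abs_of_pos ht0, ← one_div, div_sub_div _ _ ht0.ne' (d t).ne']
    congr 1
    ring
  have hcont : ContinuousOn (fun t => poissonCos t c) (Set.uIcc r 1) := by
    unfold poissonCos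
    refine ContinuousOn.div (by fun_prop) (by fun_prop) fun t ht => ?_
    exact mul_ne_zero (abs_ne_zero.2 (hpos t ht).ne') (d t).ne'
  have e1 : (1 : ℝ) + 1 ^ 2 - 2 * 1 * c = 2 - 2 * c := by ring
  have hc2 : 0 < 2 - 2 * c := by linarith [(abs_lt.1 hc).2]
  rw [← integral_Ioc_eq_integral_Ioo, ← intervalIntegral.integral_of_le hr1,
    intervalIntegral.integral_eq_sub_of_hasDerivAt hder hcont.intervalIntegrable, e1,
    Real.log_one, show -(0 - Real.log (2 - 2 * c) - (Real.log r - Real.log (1 + r ^ 2 - 2 * r * c)))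
      = Real.log (2 - 2 * c) + (Real.log r - Real.log (1 + r ^ 2 - 2 * r * c)) by ring,
    Real.exp_add, Real.exp_sub, Real.exp_log hc2, Real.exp_log hr0, Real.exp_log (d r),
    show r + 1 / r - 2 * c = (1 + r ^ 2 - 2 * r * c) / r by field_simp; ring, div_div_eq_mul_div,
    mul_div_assoc]

theorem two_le_add_one_div {r : ℝ} (hr : 0 < r) : 2 ≤ r + 1 / r := by
  have : r + 1 / r - 2 = (r - 1) ^ 2 / r := by field_simp; ring
  have : 0 ≤ (r - 1) ^ 2 / r := by positivity
  linarith

theorem integral_slitWeight_le {K : Set ℝ} (hK : IsCompact K) (h0 : (0 : ℝ) ∉ K)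
    (hK1 : K ⊆ Set.Ioo (-1) 1) {r₁ r₂ : ℝ} (hr₁ : 0 < r₁) (hr₁' : r₁ ≤ 1) (hr₂ : 0 < r₂)
    (hr₂' : r₂ ≤ 1) (hv₁ : volume (K ∩ Set.Ioi 0) = ENNReal.ofReal (1 - r₁))
    (hv₂ : volume (K ∩ Set.Iio 0) = ENNReal.ofReal (1 - r₂)) {y₁ y₂ : ℝ} (hy₁ : y₁ = r₁ + 1 / r₁)
    (hy₂ : y₂ = r₂ + 1 / r₂) :
    ∫ τ in (0 : ℝ)..Real.pi, slitWeight K (Real.cos τ) ≤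
      Real.arcsin ((4 - (y₁ - y₂)) / (y₁ + y₂)) + Real.arcsin ((4 + (y₁ - y₂)) / (y₁ + y₂)) := by
  obtain ⟨a, ha, ha1, hKa⟩ := exists_pos_lt_abs_of_isCompact hK h0
  have hpi := Real.pi_pos.le
  have hKm := hK.measurableSet
  set N : Set ℝ := (fun t : ℝ => -t) ⁻¹' K with hN
  have hNc : IsCompact N := (Homeomorph.neg ℝ).isCompact_preimage.2 hK
  have hN0 : (0 : ℝ) ∉ N := by simpa [hN] using h0
  have hN1 : N ⊆ Set.Ioo (-1) 1 := fun t ht => by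
    have := hK1 ht
    exact ⟨by linarith [this.2], by linarith [this.1]⟩
  set A₁ : Set ℝ := K ∩ Set.Ioi 0 with hA₁
  set B : Set ℝ := K ∩ Set.Iio 0 with hB
  set A₂ : Set ℝ := (fun t : ℝ => -t) ⁻¹' B with hA₂
  have hA₁m : MeasurableSet A₁ := hKm.inter measurableSet_Ioi
  have hBm : MeasurableSet B := hKm.inter measurableSet_Iio
  have hA₂m : MeasurableSet A₂ := measurable_neg hBm
  have hA₁a : A₁ ⊆ Set.Ico a 1 := fun t ht => by
    have := hKa t ht.1
    rw [abs_of_pos ht.2] at this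
    exact ⟨this, (hK1 ht.1).2⟩
  have hA₂a : A₂ ⊆ Set.Ico a 1 := fun t ht => by
    have := hKa _ ht.1
    rw [abs_of_neg ht.2, neg_neg] at this
    exact ⟨this, by linarith [(hK1 ht.1).1]⟩
  have hv₂' : volume A₂ = ENNReal.ofReal (1 - r₂) := by
    rw [← hv₂]
    exact Measure.measure_preimage_neg volume B
  have hwN : ∀ c, slitWeight N c = slitWeight K (-c) := fun c => by
    rw [slitWeight, slitWeight, setIntegral_neg_preimage_poissonCos]
  have hw := continuousOn_slitWeight hK h0 hK1
  have hwN' := continuousOn_slitWeight hNc hN0 hN1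
  have hwa := antitoneOn_slitWeight_div hK h0 hK1
  have hwNa := antitoneOn_slitWeight_div hNc hN0 hN1
  have hI₁ := integral_mul_setIntegral_poissonCos_ge hw (fun c _ => (slitWeight_pos K c).le) hwa ha
    hA₁m hA₁a hr₁ hr₁' hv₁
  have hI₂ := integral_mul_setIntegral_poissonCos_ge hwN' (fun c _ => (slitWeight_pos N c).le) hwNa
    ha hA₂m hA₂a hr₂ hr₂' hv₂'
  have i₁ := (weighted_poissonCos_interchange hw (fun c _ => (slitWeight_pos K c).le) ha
    hA₁m hA₁a).1
  have j₁ := (weighted_poissonCos_interchange hw (fun c _ => (slitWeight_pos K c).le) hr₁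
    measurableSet_Ioo (Set.Ioo_subset_Ico_self (a := r₁) (b := 1))).1
  have i₂ := (weighted_poissonCos_interchange hwN' (fun c _ => (slitWeight_pos N c).le) ha
    hA₂m hA₂a).1.comp_sub_left Real.pi
  have j₂ := (weighted_poissonCos_interchange hwN' (fun c _ => (slitWeight_pos N c).le) hr₂
    measurableSet_Ioo (Set.Ioo_subset_Ico_self (a := r₂) (b := 1))).1.comp_sub_left Real.pi
  have flip : ∀ f : ℝ → ℝ, ∫ τ in (0 : ℝ)..Real.pi, f τ = ∫ τ in (0 : ℝ)..Real.pi, f (Real.pi - τ) :=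
    fun f => by rw [intervalIntegral.integral_comp_sub_left f Real.pi]; simp
  rw [flip, flip (fun τ => slitWeight N (Real.cos τ) * ∫ t in A₂, poissonCos t (Real.cos τ))] at hI₂
  simp only [Real.cos_pi_sub, hwN, neg_neg, sub_self, sub_zero, hA₂,
    setIntegral_neg_preimage_poissonCos] at hI₂ i₂ j₂
  have i₂ := i₂.symm
  have j₂ := j₂.symm
  have hwi : IntervalIntegrable (fun τ => slitWeight K (Real.cos τ)) volume 0 Real.pi := by
    refine Continuous.intervalIntegrable ?_ _ _
    exact hw.comp_continuous Real.continuous_cos fun τ => ⟨Real.neg_one_le_cos τ, Real.cos_le_one τ⟩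
  set w : ℝ → ℝ := slitWeight K with hwdef
  set φ : ℝ → ℝ := fun τ => w (Real.cos τ) +
    1 / 2 * (((w (Real.cos τ) * ∫ t in A₁, poissonCos t (Real.cos τ)) -
      w (Real.cos τ) * ∫ t in Set.Ioo r₁ 1, poissonCos t (Real.cos τ)) +
      ((w (Real.cos τ) * ∫ t in B, poissonCos t (Real.cos τ)) -
      w (Real.cos τ) * ∫ t in Set.Ioo r₂ 1, poissonCos t (-Real.cos τ))) with hφ
  have hφi : IntervalIntegrable φ volume 0 Real.pi :=
    hwi.add (((i₁.sub j₁).add (i₂.sub j₂)).const_mul _)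
  have hφint : ∫ τ in (0 : ℝ)..Real.pi, w (Real.cos τ) ≤ ∫ τ in (0 : ℝ)..Real.pi, φ τ := by
    rw [hφ, intervalIntegral.integral_add hwi (((i₁.sub j₁).add (i₂.sub j₂)).const_mul _),
      intervalIntegral.integral_const_mul, intervalIntegral.integral_add (i₁.sub j₁) (i₂.sub j₂),
      intervalIntegral.integral_sub i₁ j₁, intervalIntegral.integral_sub i₂ j₂]
    linarith
  have hy₁2 : 2 ≤ y₁ := hy₁ ▸ two_le_add_one_div hr₁
  have hy₂2 : 2 ≤ y₂ := hy₂ ▸ two_le_add_one_div hr₂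
  set S := y₁ + y₂ with hS
  set D := y₁ - y₂ with hD
  have hSpos : 0 < S := by linarith
  refine hφint.trans ?_
  have hfac : ∀ c : ℝ, 1 - ((4 * c - D) / S) ^ 2 = 4 * ((y₁ - 2 * c) * (y₂ + 2 * c)) / S ^ 2 := by
    intro c
    field_simp
    rw [hS, hD]
    ring
  have hcos : ∀ τ ∈ Set.Ioo 0 Real.pi, |Real.cos τ| < 1 := fun τ hτ => by
    rw [← Real.sqrt_one, ← Real.sqrt_sq_eq_abs]
    have := Real.sin_pos_of_mem_Ioo hτ
    exact Real.sqrt_lt_sqrt (sq_nonneg _) (by nlinarith [Real.sin_sq_add_cos_sq τ])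
  have key := intervalIntegral.integral_le_sub_of_hasDeriv_right_of_le
    (g := fun τ => -Real.arcsin ((4 * Real.cos τ - D) / S))
    (g' := fun τ => 4 * Real.sin τ / S / √(1 - ((4 * Real.cos τ - D) / S) ^ 2)) (φ := φ) hpi
    (Continuous.continuousOn (by fun_prop)) (fun τ hτ => ?_)
    ((intervalIntegrable_iff_integrableOn_Icc_of_le hpi).1 hφi) (fun τ hτ => ?_)
  · refine key.trans (le_of_eq ?_)
    simp only [Real.cos_pi, Real.cos_zero]
    rw [show (4 * -1 - D) / S = -((4 + D) / S) by ring, Real.arcsin_neg, mul_one]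
    ring
  · have hc := abs_lt.1 (hcos τ hτ)
    have hp : 0 < 1 - ((4 * Real.cos τ - D) / S) ^ 2 := by
      rw [hfac]
      have : 0 < y₁ - 2 * Real.cos τ := by linarith
      have : 0 < y₂ + 2 * Real.cos τ := by linarith
      positivity
    have hu := abs_lt.1 ((sq_lt_one_iff_abs_lt_one ((4 * Real.cos τ - D) / S)).1 (by linarith))
    refine HasDerivAt.hasDerivWithinAt ?_
    refine ((Real.hasDerivAt_arcsin hu.1.ne' hu.2.ne).comp τ
      ((((Real.hasDerivAt_cos τ).const_mul 4).sub_const D).div_const S)).fun_neg.congr_deriv ?_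
    ring
  · have hc' := hcos τ hτ
    have hc := abs_lt.1 hc'
    have hp₁ : 0 < y₁ - 2 * Real.cos τ := by linarith
    have hp₂ : 0 < y₂ + 2 * Real.cos τ := by linarith
    have hs := Real.sin_pos_of_mem_Ioo hτ
    have hE₁ := exp_neg_setIntegral_Ioo_poissonCos hr₁ hr₁' hc'
    have hE₂ := exp_neg_setIntegral_Ioo_poissonCos hr₂ hr₂' (c := -Real.cos τ) (by rwa [abs_neg])
    rw [← hy₁] at hE₁
    rw [← hy₂] at hE₂
    have hL : ∫ t in K, poissonCos t (Real.cos τ) =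
        (∫ t in A₁, poissonCos t (Real.cos τ)) + ∫ t in B, poissonCos t (Real.cos τ) := by
      have hi := integrableOn_poissonCos hK h0 hK1 hc'.le
      have hdisj : Disjoint A₁ B :=
        Set.disjoint_left.2 fun t h1 h2 => lt_asymm (Set.mem_Ioi.1 h1.2) (Set.mem_Iio.1 h2.2)
      rw [← setIntegral_union hdisj hBm
        (hi.mono_set Set.inter_subset_left) (hi.mono_set Set.inter_subset_left)]
      congr 2
      ext t
      refine ⟨fun h => ?_, fun h => h.elim And.left And.left⟩
      rcases lt_trichotomy t 0 with h' | h' | h'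
      · exact Or.inr ⟨h, h'⟩
      · exact absurd (h' ▸ h) h0
      · exact Or.inl ⟨h, h'⟩
    set L₁ := ∫ t in A₁, poissonCos t (Real.cos τ)
    set L₂ := ∫ t in B, poissonCos t (Real.cos τ)
    set M₁ := ∫ t in Set.Ioo r₁ 1, poissonCos t (Real.cos τ)
    set M₂ := ∫ t in Set.Ioo r₂ 1, poissonCos t (-Real.cos τ)
    have hle : φ τ ≤ Real.exp (-(M₁ + M₂) / 2) := by
      have h1 : φ τ = w (Real.cos τ) * ((L₁ + L₂ - M₁ - M₂) / 2 + 1) := by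
        simp only [hφ]
        ring
      have h2 : Real.exp (-(M₁ + M₂) / 2) =
          w (Real.cos τ) * Real.exp ((L₁ + L₂ - M₁ - M₂) / 2) := by
        rw [hwdef, slitWeight, hL, ← Real.exp_add]
        congr 1
        ring
      rw [h1, h2]
      exact mul_le_mul_of_nonneg_left (Real.add_one_le_exp _) (slitWeight_pos K _).le
    refine hle.trans (abs_le_of_sq_le_sq' (le_of_eq ?_) (by positivity)).2
    rw [← Real.exp_nat_mul, show ((2 : ℕ) : ℝ) * (-(M₁ + M₂) / 2) = -M₁ + -M₂ by push_cast; ring,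
      Real.exp_add, hE₁, hE₂, div_pow, hfac, Real.sq_sqrt (by positivity), div_pow, mul_pow,
      Real.sin_sq, show y₂ - 2 * -Real.cos τ = y₂ + 2 * Real.cos τ by ring]
    field_simp
    ring

theorem arcsin_add_arcsin_le {r₁ r₂ : ℝ} (hr₁ : 0 < r₁) (hr₁' : r₁ ≤ 1) (hr₂ : 0 < r₂)
    (hr₂' : r₂ ≤ 1) {y₁ y₂ r : ℝ} (hy₁ : y₁ = r₁ + 1 / r₁) (hy₂ : y₂ = r₂ + 1 / r₂)
    (hr : r = (r₁ + r₂) / 2) :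
    Real.arcsin ((4 - (y₁ - y₂)) / (y₁ + y₂)) + Real.arcsin ((4 + (y₁ - y₂)) / (y₁ + y₂)) ≤
      Real.pi - 2 * Real.arcsin ((1 - r ^ 2) / (1 + r ^ 2)) := by
  have hy₁2 : 2 ≤ y₁ := hy₁ ▸ two_le_add_one_div hr₁
  have hy₂2 : 2 ≤ y₂ := hy₂ ▸ two_le_add_one_div hr₂
  have hS : 0 < y₁ + y₂ := by linarith
  have hr0 : 0 < r := by rw [hr]; positivity
  have hr1 : r ≤ 1 := by linarith
  set a := (4 - (y₁ - y₂)) / (y₁ + y₂) with ha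
  set b := (4 + (y₁ - y₂)) / (y₁ + y₂) with hb
  set q := (1 - r ^ 2) / (1 + r ^ 2) with hq
  have hab : 0 ≤ a + b := by
    rw [ha, hb, ← add_div]
    exact div_nonneg (by linarith) hS.le
  have ha1 : a ≤ 1 := by rw [ha, div_le_one hS]; linarith
  have hb1 : b ≤ 1 := by rw [hb, div_le_one hS]; linarith
  have ha2 : -1 ≤ a := by linarith
  have hb2 : -1 ≤ b := by linarith
  have hJ0 : 0 ≤ Real.arcsin a + Real.arcsin b := by
    have := Real.monotone_arcsin (show -b ≤ a by linarith)
    rw [Real.arcsin_neg] at this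
    linarith
  have hJ1 : Real.arcsin a + Real.arcsin b ≤ Real.pi := by
    linarith [Real.arcsin_le_pi_div_two a, Real.arcsin_le_pi_div_two b]
  have hq0 : 0 ≤ q := div_nonneg (by nlinarith) (by positivity)
  have hq1 : q ≤ 1 := (div_le_one (by positivity)).2 (by nlinarith)
  have hQ0 := Real.arcsin_nonneg.2 hq0
  have hQ1 := Real.arcsin_le_pi_div_two q
  refine (Real.strictAntiOn_cos.le_iff_ge ⟨by linarith, by linarith⟩ ⟨hJ0, hJ1⟩).1 ?_
  have hcJ : Real.cos (Real.arcsin a + Real.arcsin b) = 1 - 8 * (r₁ * r₂) / (1 + r₁ * r₂) ^ 2 := by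
    rw [Real.cos_add, Real.cos_arcsin, Real.cos_arcsin, Real.sin_arcsin ha2 ha1,
      Real.sin_arcsin hb2 hb1, ← Real.sqrt_mul (by nlinarith)]
    have h1 : (1 - a ^ 2) * (1 - b ^ 2) =
        (4 * (1 / r₁ - r₁) * (1 / r₂ - r₂) / (y₁ + y₂) ^ 2) ^ 2 := by
      have e₁ : (1 / r₁ - r₁) ^ 2 = y₁ ^ 2 - 4 := by rw [hy₁]; field_simp; ring
      have e₂ : (1 / r₂ - r₂) ^ 2 = y₂ ^ 2 - 4 := by rw [hy₂]; field_simp; ring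
      have e₃ : ∀ x z s : ℝ, (4 * x * z / s ^ 2) ^ 2 = 16 * x ^ 2 * z ^ 2 / s ^ 4 := by
        intro x z s
        ring
      rw [e₃, e₁, e₂, ha, hb]
      field_simp
      ring
    have p₁ : 0 ≤ 1 / r₁ - r₁ := by linarith [one_le_one_div hr₁ hr₁']
    have p₂ : 0 ≤ 1 / r₂ - r₂ := by linarith [one_le_one_div hr₂ hr₂']
    rw [h1, Real.sqrt_sq (by positivity), ha, hb]
    have hy : y₁ + y₂ = (r₁ + r₂) * (1 + r₁ * r₂) / (r₁ * r₂) := by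
      rw [hy₁, hy₂]; field_simp; ring
    have hd : y₁ - y₂ = (r₂ - r₁) * (1 - r₁ * r₂) / (r₁ * r₂) := by
      rw [hy₁, hy₂]; field_simp; ring
    rw [hy, hd]
    field_simp
    ring
  have hcq : Real.cos (Real.pi - 2 * Real.arcsin q) = 1 - 8 * r ^ 2 / (1 + r ^ 2) ^ 2 := by
    rw [Real.cos_pi_sub, Real.cos_two_mul, Real.cos_arcsin, Real.sq_sqrt (by nlinarith), hq]
    field_simp
    ring
  have hle : r₁ * r₂ ≤ r ^ 2 := by rw [hr]; nlinarith [sq_nonneg (r₁ - r₂)]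
  have hr2 : r ^ 2 ≤ 1 := by nlinarith
  have hp : 0 < r₁ * r₂ := by positivity
  rw [hcJ, hcq]
  have : 8 * (r₁ * r₂) / (1 + r₁ * r₂) ^ 2 ≤ 8 * r ^ 2 / (1 + r ^ 2) ^ 2 := by
    rw [div_le_div_iff₀ (by positivity) (by positivity)]
    have h1 : 0 ≤ (r ^ 2 - r₁ * r₂) * (1 - r ^ 2 * (r₁ * r₂)) :=
      mul_nonneg (by linarith) (by nlinarith)
    nlinarith
  linarith

theorem volume_eq_ofReal_one_sub {s : Set ℝ} {ρ : ℝ} (hρ0 : 0 ≤ ρ) (hρ1 : ρ < 1)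
    (hs : volume s ≤ ENNReal.ofReal ρ) :
    ∃ r, 0 < r ∧ r ≤ 1 ∧ volume s = ENNReal.ofReal (1 - r) := by
  have hfin : volume s ≠ ⊤ := ne_top_of_le_ne_top ENNReal.ofReal_ne_top hs
  have h1 : (volume s).toReal ≤ ρ := ENNReal.toReal_le_of_le_ofReal hρ0 hs
  refine ⟨1 - (volume s).toReal, by linarith, by linarith [ENNReal.toReal_nonneg (a := volume s)],
    ?_⟩
  rw [sub_sub_cancel, ENNReal.ofReal_toReal hfin]

theorem volume_le_volume_dilate_inter {K : Set ℝ} (hK : K ⊆ Set.Icc (-1 : ℝ) 1) {ρ : ℝ}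
    (hρ0 : 0 < ρ) (hρ1 : ρ < 1) :
    ENNReal.ofReal ρ⁻¹ * volume K ≤
      volume ({t : ℝ | ρ * t ∈ K} ∩ Set.Icc (-ρ) ρ) + ENNReal.ofReal (2 * (ρ⁻¹ - ρ)) := by
  have hinv : ρ < ρ⁻¹ := hρ1.trans ((one_lt_inv₀ hρ0).2 hρ1)
  have h1 : volume {t : ℝ | ρ * t ∈ K} = ENNReal.ofReal ρ⁻¹ * volume K := by
    have := Real.volume_preimage_mul_left hρ0.ne' K
    rwa [abs_of_pos (inv_pos.2 hρ0)] at this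
  rw [← h1]
  have h2 : {t : ℝ | ρ * t ∈ K} ⊆ ({t : ℝ | ρ * t ∈ K} ∩ Set.Icc (-ρ) ρ) ∪
      (Set.Ioc ρ ρ⁻¹ ∪ Set.Ico (-ρ⁻¹) (-ρ)) := by
    intro t ht
    have hb := hK ht
    have e : t = ρ⁻¹ * (ρ * t) := by field_simp
    have hi := inv_pos.2 hρ0
    have u : t ≤ ρ⁻¹ := by rw [e]; nlinarith [hb.2]
    have l : -ρ⁻¹ ≤ t := by rw [e]; nlinarith [hb.1]
    rcases lt_or_ge ρ t with h | h
    · exact Or.inr (Or.inl ⟨h, u⟩)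
    rcases lt_or_ge t (-ρ) with h' | h'
    · exact Or.inr (Or.inr ⟨l, h'⟩)
    · exact Or.inl ⟨ht, h', h⟩
  refine (measure_mono h2).trans ((measure_union_le _ _).trans (add_le_add_right ?_ _))
  refine (measure_union_le _ _).trans ?_
  rw [Real.volume_Ioc, Real.volume_Ico, ← ENNReal.ofReal_add (by linarith) (by linarith)]
  exact ENNReal.ofReal_le_ofReal (by linarith)

theorem solynin_lower_bound_dilate {lam : ℝ} {K : Set ℝ} (hK : IsClosed K)
    (hKsub : K ⊆ Set.Icc (-1 : ℝ) 1) (hKmeas : volume K = ENNReal.ofReal (2 * lam))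
    (h0 : (0 : ℝ) ∉ K) {ω : ℂ → ℝ}
    (hω : IsHarmonicMeasureFn ω (Metric.ball (0 : ℂ) 1) (Complex.ofReal '' K)) {ρ : ℝ}
    (hρ0 : 0 < ρ) (hρ1 : ρ < 1) :
    2 / Real.pi * Real.arcsin ((1 - (1 - ρ⁻¹ * lam + (ρ⁻¹ - ρ)) ^ 2) /
      (1 + (1 - ρ⁻¹ * lam + (ρ⁻¹ - ρ)) ^ 2)) ≤ ω 0 := by
  have hmain := pi_mul_one_sub_le hK h0 hω hρ0 hρ1
  set K' : Set ℝ := {t : ℝ | ρ * t ∈ K} ∩ Set.Icc (-ρ) ρ with hK'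
  have hc : IsCompact K' :=
    isCompact_Icc.inter_left (hK.preimage (continuous_const.mul continuous_id))
  have h0' : (0 : ℝ) ∉ K' := fun h => h0 (by simpa using h.1)
  have h1' : K' ⊆ Set.Ioo (-1) 1 := fun t ht => ⟨by linarith [ht.2.1], by linarith [ht.2.2]⟩
  obtain ⟨r₁, hr₁, hr₁', hv₁⟩ := volume_eq_ofReal_one_sub (s := K' ∩ Set.Ioi 0) hρ0.le hρ1 (by
    have hsub : K' ∩ Set.Ioi 0 ⊆ Set.Ioc 0 ρ := fun t ht => ⟨ht.2, ht.1.2.2⟩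
    refine (measure_mono hsub).trans ?_
    rw [Real.volume_Ioc, sub_zero])
  obtain ⟨r₂, hr₂, hr₂', hv₂⟩ := volume_eq_ofReal_one_sub (s := K' ∩ Set.Iio 0) hρ0.le hρ1 (by
    have hsub : K' ∩ Set.Iio 0 ⊆ Set.Ico (-ρ) 0 := fun t ht => ⟨ht.1.2.1, ht.2⟩
    refine (measure_mono hsub).trans ?_
    rw [Real.volume_Ico, zero_sub, neg_neg])
  have hle := integral_slitWeight_le hc h0' h1' hr₁ hr₁' hr₂ hr₂' hv₁ hv₂ rfl rfl
  have hJ := arcsin_add_arcsin_le hr₁ hr₁' hr₂ hr₂' rfl rfl rfl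
  have hvol : volume K' ≤ ENNReal.ofReal (2 - (r₁ + r₂)) := by
    have hu : K' ⊆ (K' ∩ Set.Ioi 0) ∪ (K' ∩ Set.Iio 0) := fun t ht => by
      rcases lt_trichotomy t 0 with h | h | h
      · exact Or.inr ⟨ht, h⟩
      · exact absurd (h ▸ ht) h0'
      · exact Or.inl ⟨ht, h⟩
    refine (measure_mono hu).trans ((measure_union_le _ _).trans ?_)
    rw [hv₁, hv₂, ← ENNReal.ofReal_add (by linarith) (by linarith)]
    exact ENNReal.ofReal_le_ofReal (by linarith)
  have hinv : 0 < ρ⁻¹ - ρ := sub_pos.2 (hρ1.trans ((one_lt_inv₀ hρ0).2 hρ1))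
  have hsum : ρ⁻¹ * (2 * lam) ≤ 2 - (r₁ + r₂) + 2 * (ρ⁻¹ - ρ) := by
    have h := (volume_le_volume_dilate_inter hKsub hρ0 hρ1).trans (add_le_add_left hvol _)
    rw [hKmeas, ← ENNReal.ofReal_mul (by positivity),
      ← ENNReal.ofReal_add (by linarith) (by linarith)] at h
    exact (ENNReal.ofReal_le_ofReal_iff (by linarith)).1 h
  set r := (r₁ + r₂) / 2 with hr
  set s := 1 - ρ⁻¹ * lam + (ρ⁻¹ - ρ) with hs
  have hrs : r ^ 2 ≤ s ^ 2 := pow_le_pow_left₀ (by positivity) (by linarith) 2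
  have hq : (1 - s ^ 2) / (1 + s ^ 2) ≤ (1 - r ^ 2) / (1 + r ^ 2) := by
    rw [div_le_div_iff₀ (by positivity) (by positivity)]
    nlinarith
  have ha := Real.monotone_arcsin hq
  have hfin : Real.pi * (1 - ω 0) ≤
      Real.pi - 2 * Real.arcsin ((1 - r ^ 2) / (1 + r ^ 2)) := hmain.trans (hle.trans hJ)
  rw [div_mul_eq_mul_div, div_le_iff₀ Real.pi_pos]
  nlinarith

/-- Solynin's extremal estimate (lower bound): for a closed `K ⊆ [−1,1]` with
`|K| = 2λ`, `0 < λ < 1`, `0 ∉ K`, and a harmonic measure function `ω` of `K`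
(regarded as a subset of `ℂ`) with respect to the unit disk `𝔻`, one has
`ω(0) ≥ (2/π)·arcsin((1−(1−λ)²)/(1+(1−λ)²))`. -/
theorem solynin_lower_bound
    (lam : ℝ) (hlam0 : 0 < lam) (hlam1 : lam < 1)
    (K : Set ℝ) (hKclosed : IsClosed K) (hKsub : K ⊆ Set.Icc (-1 : ℝ) 1)
    (hKmeas : volume K = ENNReal.ofReal (2 * lam))
    (h0K : (0 : ℝ) ∉ K)
    (ω : ℂ → ℝ)
    (hω : IsHarmonicMeasureFn ω (Metric.ball (0 : ℂ) 1) (Complex.ofReal '' K)) :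
    2 / Real.pi * Real.arcsin ((1 - (1 - lam) ^ 2) / (1 + (1 - lam) ^ 2))
      ≤ ω 0 := by
  have hcont : ContinuousAt (fun ρ : ℝ => 2 / Real.pi *
      Real.arcsin ((1 - (1 - ρ⁻¹ * lam + (ρ⁻¹ - ρ)) ^ 2) /
        (1 + (1 - ρ⁻¹ * lam + (ρ⁻¹ - ρ)) ^ 2))) 1 := by
    have hinv : ContinuousAt (fun ρ : ℝ => ρ⁻¹) 1 := continuousAt_inv₀ one_ne_zero
    have hs : ContinuousAt (fun ρ : ℝ => (1 - ρ⁻¹ * lam + (ρ⁻¹ - ρ)) ^ 2) 1 :=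
      (((hinv.mul_const lam).const_sub 1).add (hinv.sub continuousAt_id)).pow 2
    refine continuousAt_const.mul (Real.continuous_arcsin.continuousAt.comp ?_)
    exact (continuousAt_const.sub hs).div (continuousAt_const.add hs) (by positivity)
  have hlim := hcont.tendsto.mono_left (nhdsWithin_le_nhds (s := Set.Iio 1))
  simp only [inv_one, one_mul, sub_self, add_zero] at hlim
  refine le_of_tendsto hlim ?_
  filter_upwards [Ioo_mem_nhdsLT (zero_lt_one (α := ℝ))] with ρ hρ
  exact solynin_lower_bound_dilate hKclosed hKsub hKmeas h0K hω hρ.1 hρ.2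
end

section
/- Explicit harmonic measure of the extremal set: Let 0 < λ < 1 and set K_λ = [−1, −1+λ] ∪ [1−λ, 1] ⊆ ℝ ⊆ ℂ. Let 𝔻 denote the open unit disk in ℂ and let ω be a harmonic measure function of K_λ with respect to 𝔻. Then ω(0) = (2/π) · arcsin( (1 − (1−λ)²) / (1 + (1−λ)²) ). -/
open Complex MeasureTheory Metric Filter Set

open InnerProductSpace Topology

/-- Harmonicity in the sense of the planar Laplacian on an open set implies harmonicity
in the sense of `InnerProductSpace.HarmonicOnNhd`. -/
lemma HarmonicOnSet.harmonicOnNhd {u : ℂ → ℝ} {U : Set ℂ} (hU : IsOpen U)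
    (h : HarmonicOnSet u U) : HarmonicOnNhd u U := by
  intro x hx
  refine ⟨h.1.contDiffAt (hU.mem_nhds hx), ?_⟩
  filter_upwards [hU.mem_nhds hx] with z hz
  have hcd : ContDiffAt ℝ 2 u z := h.1.contDiffAt (hU.mem_nhds hz)
  have hd : DifferentiableAt ℝ (fderiv ℝ u) z :=
    (hcd.fderiv_right (m := 1) (by norm_num)).differentiableAt (by norm_num)
  have key : ∀ v : ℂ, fderiv ℝ (fun w => fderiv ℝ u w v) z v
      = iteratedFDeriv ℝ 2 u z ![v, v] := by
    intro v
    rw [iteratedFDeriv_two_apply, fderiv_clm_apply hd (differentiableAt_const v)]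
    simp
  have h0 := h.2 z hz
  rw [planarLaplacian, key, key] at h0
  rw [laplacian_eq_iteratedFDeriv_complexPlane]
  simpa using h0

/-- A harmonic function composed with an analytic function is harmonic. -/
lemma InnerProductSpace.HarmonicAt.comp_analyticAt {u : ℂ → ℝ} {f : ℂ → ℂ} {x : ℂ}
    (hu : HarmonicAt u (f x)) (hf : AnalyticAt ℂ f x) : HarmonicAt (u ∘ f) x := by
  obtain ⟨ε, hε, hball⟩ := Metric.isOpen_iff.1 (isOpen_setOfPred_harmonicAt (f := u)) _ hu
  obtain ⟨F, hF, hFu⟩ :=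
    HarmonicOnNhd.exists_analyticOnNhd_ball_re_eq (fun _ hy ↦ hball hy)
  have hA : AnalyticAt ℂ (F ∘ f) x := (hF _ (mem_ball_self hε)).comp hf
  refine (harmonicAt_congr_nhds ?_).1 hA.harmonicAt_re
  filter_upwards [hf.continuousAt.preimage_mem_nhds (ball_mem_nhds _ hε)] with y hy
  exact hFu hy

/-- A root of a self-reciprocal real quadratic polynomial is real or has modulus one. -/
lemma im_eq_zero_or_norm_eq_one {a b : ℝ} (ha : a ≠ 0) {z : ℂ}
    (h : (a : ℂ) * (1 + z ^ 2) = b * z) :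
    (z.im = 0 ∧ a * (1 + z.re ^ 2) = b * z.re) ∨ (‖z‖ = 1 ∧ b = 2 * a * z.re) := by
  have h1 := congrArg Complex.re h
  have h2 := congrArg Complex.im h
  simp [pow_two] at h1 h2
  by_cases hq : z.im = 0
  · left
    refine ⟨hq, ?_⟩
    rw [hq] at h1
    linarith
  · right
    have hb : b = 2 * a * z.re := by
      apply mul_right_cancel₀ hq
      linarith
    refine ⟨?_, hb⟩
    have h3 : a * (z.re ^ 2 + z.im ^ 2) = a * 1 := by rw [hb] at h1; linarith
    have h4 := mul_left_cancel₀ ha h3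
    rw [Complex.norm_eq_sqrt_sq_add_sq, h4, Real.sqrt_one]

lemma norm_eq_one_of_quadratic {a b : ℝ} (ha : a ≠ 0) (hab : |b| ≤ 2 * |a|) {z : ℂ}
    (h : (a : ℂ) * (1 + z ^ 2) = b * z) : ‖z‖ = 1 := by
  rcases im_eq_zero_or_norm_eq_one ha h with ⟨him, hre⟩ | ⟨hn, -⟩
  · have h1 : |a| * (1 + |z.re| ^ 2) = |b| * |z.re| := by
      rw [← abs_mul, ← hre, abs_mul, sq_abs, abs_of_pos (by positivity : 0 < 1 + z.re ^ 2)]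
    have ha' : 0 < |a| := abs_pos.2 ha
    have h2 : |a| * (1 - |z.re|) ^ 2 ≤ 0 := by
      nlinarith [mul_le_mul_of_nonneg_right hab (abs_nonneg z.re)]
    have h3 : (1 - |z.re|) ^ 2 = 0 := by
      have := sq_nonneg (1 - |z.re|)
      nlinarith
    have h4 : |z.re| = 1 := by
      have := pow_eq_zero_iff (two_ne_zero) |>.1 h3
      linarith
    rw [← Complex.abs_re_eq_norm.2 him, h4]
  · exact hn

lemma im_eq_zero_of_quadratic {a b : ℝ} (ha : a ≠ 0) (hab : 2 * |a| < |b|) {z : ℂ}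
    (hz : ‖z‖ ≤ 1) (h : (a : ℂ) * (1 + z ^ 2) = b * z) :
    z.im = 0 ∧ |z.re| < 1 ∧ |a| * (1 + |z.re| ^ 2) = |b| * |z.re| := by
  have hre1 : |z.re| ≤ 1 := (Complex.abs_re_le_norm z).trans hz
  rcases im_eq_zero_or_norm_eq_one ha h with ⟨him, hre⟩ | ⟨-, hb⟩
  · have h1 : |a| * (1 + |z.re| ^ 2) = |b| * |z.re| := by
      rw [← abs_mul, ← hre, abs_mul, sq_abs, abs_of_pos (by positivity : 0 < 1 + z.re ^ 2)]
    refine ⟨him, lt_of_le_of_ne hre1 ?_, h1⟩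
    intro h2
    rw [h2] at h1
    linarith
  · exfalso
    rw [hb, abs_mul, abs_mul, abs_two] at hab
    nlinarith [abs_nonneg a]

lemma one_add_sq_ne_zero {z : ℂ} (hz : ‖z‖ < 1) : 1 + z ^ 2 ≠ 0 := by
  intro h
  have h1 : z ^ 2 = -1 := by linear_combination h
  have h2 : ‖z‖ ^ 2 = 1 := by rw [← norm_pow, h1]; simp
  nlinarith [norm_nonneg z]

/-- The solution in the unit disc of `z + 1 / z = (ζ + 1 / ζ) / c` is an analytic
function of `ζ` in the unit disc. -/
lemma exists_analyticOnNhd_joukowski {c : ℝ} (hc0 : 0 < c) (hc1 : c < 1) :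
    ∃ φ : ℂ → ℂ, AnalyticOnNhd ℂ φ (ball 0 1) ∧ ∀ ζ ∈ ball (0 : ℂ) 1,
      ‖φ ζ‖ < 1 ∧ φ ζ * (1 + ζ ^ 2) = c * ζ * (1 + φ ζ ^ 2) := by
  let w : ℂ → ℂ := fun ζ => c * ζ / (1 + ζ ^ 2)
  let s : ℂ → ℂ := fun ζ => (1 - 4 * w ζ ^ 2) ^ (2⁻¹ : ℂ)
  have hsl : ∀ ζ : ℂ, ‖ζ‖ < 1 → 1 - 4 * w ζ ^ 2 ∈ slitPlane := by
    intro ζ hζ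
    by_contra hcon
    rw [Complex.mem_slitPlane_iff] at hcon
    push Not at hcon
    obtain ⟨h1, h2⟩ := hcon
    have e1 : (1 - 4 * w ζ ^ 2).re = 1 - 4 * ((w ζ).re ^ 2 - (w ζ).im ^ 2) := by
      simp [pow_two]
    have e2 : (1 - 4 * w ζ ^ 2).im = - 8 * ((w ζ).re * (w ζ).im) := by
      simp [pow_two]; ring
    rw [e1] at h1
    rw [e2] at h2
    have him : (w ζ).im = 0 := by
      rcases mul_eq_zero.1 (by linarith : (w ζ).re * (w ζ).im = 0) with h | h
      · rw [h] at h1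
        nlinarith [sq_nonneg (w ζ).im]
      · exact h
    have hw : w ζ = ((w ζ).re : ℂ) := by
      apply Complex.ext <;> simp [him]
    rw [him] at h1
    have ht : 1 ≤ 2 * |(w ζ).re| := by
      rw [← sq_abs (w ζ).re] at h1
      nlinarith [abs_nonneg (w ζ).re]
    have heq : ((w ζ).re : ℂ) * (1 + ζ ^ 2) = c * ζ := by
      rw [← hw]
      exact div_mul_cancel₀ _ (one_add_sq_ne_zero hζ)
    have := norm_eq_one_of_quadratic (a := (w ζ).re) (b := c) ?_ ?_ heq
    · linarith
    · intro h0
      rw [h0] at ht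
      norm_num at ht
    · rw [abs_of_pos hc0]; linarith
  have hs2 : ∀ ζ : ℂ, s ζ ^ 2 = 1 - 4 * w ζ ^ 2 := fun ζ => by
    simp only [s]
    exact Complex.cpow_ofNat_inv_pow _ 2
  have hsre : ∀ ζ : ℂ, ‖ζ‖ < 1 → 0 < (s ζ).re := by
    intro ζ hζ
    simp only [s]
    rw [Complex.cpow_inv_two_re]
    apply Real.sqrt_pos.2
    have h1 := hsl ζ hζ
    have h2 := Complex.abs_re_le_norm (1 - 4 * w ζ ^ 2)
    have h3 := neg_abs_le (1 - 4 * w ζ ^ 2).re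
    rcases (by linarith : 0 ≤ ‖1 - 4 * w ζ ^ 2‖ + (1 - 4 * w ζ ^ 2).re).lt_or_eq with h | h
    · linarith
    · exfalso
      have h4 := (Complex.mem_slitPlane_iff_not_le_zero.1 h1)
      apply h4
      rw [← Complex.re_eq_neg_norm]
      linarith
  have hs1 : ∀ ζ : ℂ, ‖ζ‖ < 1 → 1 + s ζ ≠ 0 := by
    intro ζ hζ h
    have := congrArg Complex.re h
    simp at this
    linarith [hsre ζ hζ]
  refine ⟨fun ζ => 2 * w ζ / (1 + s ζ), ?_, ?_⟩
  · intro ζ hζ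
    rw [mem_ball_zero_iff] at hζ
    have hwa : AnalyticAt ℂ w ζ := by
      refine AnalyticAt.div ?_ ?_ (one_add_sq_ne_zero hζ) <;> fun_prop
    have hsa : AnalyticAt ℂ s ζ := by
      refine AnalyticAt.cpow ?_ analyticAt_const (hsl ζ hζ)
      fun_prop
    refine AnalyticAt.div ?_ ?_ (hs1 ζ hζ) <;> fun_prop
  · intro ζ hζ
    rw [mem_ball_zero_iff] at hζ
    have hS := hs1 ζ hζ
    have hR := hsre ζ hζ
    have hw : w ζ * (1 + ζ ^ 2) = c * ζ := div_mul_cancel₀ _ (one_add_sq_ne_zero hζ)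
    have hq := hs2 ζ
    simp only
    generalize w ζ = v at *
    generalize s ζ = t at *
    have hφ2 : (2 * v / (1 + t)) ^ 2 * (1 + t) = 1 - t := by
      field_simp
      linear_combination hq
    constructor
    · have hlt : ‖1 - t‖ < ‖1 + t‖ := by
        rw [Complex.norm_eq_sqrt_sq_add_sq, Complex.norm_eq_sqrt_sq_add_sq]
        apply Real.sqrt_lt_sqrt (by positivity)
        simp
        nlinarith
      rw [← hφ2, norm_mul, norm_pow] at hlt
      have hp : 0 < ‖1 + t‖ := norm_pos_iff.2 hS
      have h1 : ‖2 * v / (1 + t)‖ ^ 2 < 1 := by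
        by_contra! hge
        nlinarith
      nlinarith [norm_nonneg (2 * v / (1 + t))]
    · rw [← hw]
      have h3 : 1 + (2 * v / (1 + t)) ^ 2 = 2 / (1 + t) := by
        rw [eq_div_iff hS]
        linear_combination hφ2
      rw [h3]
      ring

/-- The integral over a period of the indicator of `{θ | c < |cos θ|}`. -/
lemma integral_indicator_lt_abs_cos {c : ℝ} (hc0 : 0 < c) (hc1 : c < 1) :
    ∫ θ in (0 : ℝ)..2 * Real.pi, (if c < |Real.cos θ| then (1 : ℝ) else 0)
      = 4 * Real.arccos c := by
  set g : ℝ → ℝ := fun θ => if c < |Real.cos θ| then (1 : ℝ) else 0 with hg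
  have hper : Function.Periodic g Real.pi := by
    intro θ
    simp [hg, Real.cos_add_pi]
  have hmeas : Measurable g :=
    Measurable.ite (measurableSet_lt measurable_const (by fun_prop)) measurable_const
      measurable_const
  have hii : ∀ a b : ℝ, IntervalIntegrable g volume a b := by
    intro a b
    refine (intervalIntegrable_const (c := (1 : ℝ))).mono_fun hmeas.aestronglyMeasurable ?_
    refine ae_of_all _ fun θ => ?_
    simp only [hg]
    split_ifs <;> simp
  have hpi := Real.pi_pos
  have hsplit : ∫ θ in (0 : ℝ)..2 * Real.pi, g θ
      = 2 * ∫ θ in (-(Real.pi / 2))..(Real.pi / 2), g θ := by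
    rw [← intervalIntegral.integral_add_adjacent_intervals (hii 0 Real.pi) (hii _ _)]
    have h1 := hper.intervalIntegral_add_eq 0 (-(Real.pi / 2))
    have h2 := hper.intervalIntegral_add_eq Real.pi (-(Real.pi / 2))
    rw [zero_add, show -(Real.pi / 2) + Real.pi = Real.pi / 2 by ring] at h1
    rw [show -(Real.pi / 2) + Real.pi = Real.pi / 2 by ring,
      show Real.pi + Real.pi = 2 * Real.pi by ring] at h2
    rw [h1, h2]
    ring
  set α := Real.arccos c with hα
  have hα0 : 0 < α := Real.arccos_pos.2 hc1
  have hα1 : α < Real.pi / 2 := Real.arccos_lt_pi_div_two.2 hc0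
  have hcosα : Real.cos α = c := Real.cos_arccos (by linarith) hc1.le
  have hcenter : ∫ θ in (-(Real.pi / 2))..(Real.pi / 2), g θ = 2 * α := by
    rw [intervalIntegral.integral_of_le (by linarith)]
    have hind : EqOn g ((Ioo (-α) α).indicator fun _ => (1 : ℝ))
        (Ioc (-(Real.pi / 2)) (Real.pi / 2)) := by
      intro θ hθ
      have hcn : 0 ≤ Real.cos θ := Real.cos_nonneg_of_mem_Icc ⟨hθ.1.le, hθ.2⟩
      have hiff : c < |Real.cos θ| ↔ θ ∈ Ioo (-α) α := by
        rw [abs_of_nonneg hcn, ← hcosα, ← Real.cos_abs θ,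
          Real.strictAntiOn_cos.lt_iff_gt ⟨hα0.le, by linarith⟩
            ⟨abs_nonneg θ, (abs_le.2 ⟨hθ.1.le, hθ.2⟩).trans (by linarith)⟩, abs_lt, mem_Ioo]
      simp only [hg, indicator, hiff]
    rw [setIntegral_congr_fun measurableSet_Ioc hind, setIntegral_indicator measurableSet_Ioo,
      inter_eq_self_of_subset_right]
    · simp
      rw [max_eq_left (by linarith)]
      ring
    · intro θ hθ
      exact ⟨by linarith [hθ.1], by linarith [hθ.2]⟩
  rw [hsplit, hcenter]
  ring

/-- Level sets of the cosine are countable. -/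
lemma countable_cos_eq_cos (a : ℝ) : {θ : ℝ | Real.cos θ = Real.cos a}.Countable := by
  refine ((countable_range fun k : ℤ => 2 * k * Real.pi + a).union
    (countable_range fun k : ℤ => 2 * k * Real.pi - a)).mono ?_
  intro θ hθ
  obtain ⟨k, hk | hk⟩ := Real.cos_eq_cos_iff.1 (Eq.symm hθ)
  · exact Or.inl ⟨k, hk.symm⟩
  · exact Or.inr ⟨k, hk.symm⟩

lemma ae_abs_cos_ne (c : ℝ) : ∀ᵐ θ : ℝ, |Real.cos θ| ≠ c := by
  have hcount : {θ : ℝ | |Real.cos θ| = c}.Countable := by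
    by_cases hne : ∃ a, |Real.cos a| = c
    · obtain ⟨a, ha⟩ := hne
      refine ((countable_cos_eq_cos a).union (countable_cos_eq_cos (Real.pi - a))).mono ?_
      intro θ hθ
      rcases abs_eq_abs.1 (hθ.trans ha.symm) with h | h
      · exact Or.inl h
      · exact Or.inr (h.trans (Real.cos_pi_sub a).symm)
    · push Not at hne
      simp [hne]
  exact measure_eq_zero_iff_ae_notMem.1 (hcount.measure_zero volume)

/-- Mean value computation of `u 0`, for a bounded harmonic function `u` on an open set `U`,
by pulling `u` back under an analytic map from the unit disc. -/
lemma harmonic_apply_eq_of_radial_limits {u : ℂ → ℝ} {U : Set ℂ} {φ : ℂ → ℂ} {g : ℝ → ℝ}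
    (hu : HarmonicOnNhd u U) (hbd : ∀ z ∈ U, |u z| ≤ 1)
    (hφ : AnalyticOnNhd ℂ φ (ball 0 1)) (hmaps : MapsTo φ (ball 0 1) U)
    (hlim : ∀ᵐ θ : ℝ, Tendsto (fun ρ : ℝ => u (φ (circleMap 0 ρ θ))) (𝓝[<] 1) (𝓝 (g θ))) :
    u (φ 0) = (2 * Real.pi)⁻¹ * ∫ θ in (0 : ℝ)..2 * Real.pi, g θ := by
  have hharm : HarmonicOnNhd (u ∘ φ) (ball 0 1) := fun z hz =>
    (hu _ (hmaps hz)).comp_analyticAt (hφ z hz)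
  have hρ : ∀ᶠ ρ : ℝ in 𝓝[<] 1, 0 < ρ ∧ ρ < 1 := by
    filter_upwards [Ioo_mem_nhdsLT (zero_lt_one' ℝ)] with ρ h using h
  have hmem : ∀ ρ : ℝ, 0 < ρ ∧ ρ < 1 → ∀ θ, circleMap 0 ρ θ ∈ ball (0 : ℂ) 1 := by
    intro ρ h θ
    rw [mem_ball_zero_iff, norm_circleMap_zero, abs_of_pos h.1]
    exact h.2
  have hcont : ∀ ρ : ℝ, 0 < ρ ∧ ρ < 1 → Continuous fun θ => u (φ (circleMap 0 ρ θ)) := by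
    intro ρ h
    exact hharm.contDiffOn.continuousOn.comp_continuous (continuous_circleMap 0 ρ) (hmem ρ h)
  have hT : Tendsto (fun ρ : ℝ => ∫ θ in (0 : ℝ)..2 * Real.pi, u (φ (circleMap 0 ρ θ)))
      (𝓝[<] 1) (𝓝 (∫ θ in (0 : ℝ)..2 * Real.pi, g θ)) := by
    apply intervalIntegral.tendsto_integral_filter_of_dominated_convergence (fun _ => (1 : ℝ))
    · filter_upwards [hρ] with ρ h using (hcont ρ h).aestronglyMeasurable
    · filter_upwards [hρ] with ρ h
      exact ae_of_all _ fun θ _ => hbd _ (hmaps (hmem ρ h θ))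
    · exact intervalIntegrable_const
    · filter_upwards [hlim] with θ h _ using h
  have hT2 := hT.const_mul (2 * Real.pi)⁻¹
  refine tendsto_nhds_unique (tendsto_const_nhds.congr' ?_) hT2
  filter_upwards [hρ] with ρ h
  have := InnerProductSpace.HarmonicOnNhd.circleAverage_eq (f := u ∘ φ) (c := 0) (R := ρ) (hharm.mono ?_)
  · rw [Real.circleAverage_def] at this
    simpa using this.symm
  · rw [abs_of_pos h.1]
    exact closedBall_subset_ball h.2

/-- If every limit point of `f` along `l` is a point where `u` has limit `a`, then
`u ∘ f` tends to `a` along `l`. -/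
lemma tendsto_comp_of_forall_ultrafilter {X Y Z : Type*} [TopologicalSpace Y]
    [TopologicalSpace Z] {l : Filter X} {f : X → Y} {u : Y → Z} {C U : Set Y} {a : Z}
    (hC : IsCompact C) (hfC : ∀ᶠ x in l, f x ∈ C) (hfU : ∀ᶠ x in l, f x ∈ U)
    (h : ∀ (F : Ultrafilter X) (y : Y), ↑F ≤ l → y ∈ C → Tendsto f F (𝓝 y) →
      Tendsto u (𝓝[U] y) (𝓝 a)) : Tendsto (u ∘ f) l (𝓝 a) := by
  rw [tendsto_iff_ultrafilter]
  intro F hF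
  obtain ⟨y, hy, hFy⟩ := hC.ultrafilter_le_nhds' (F.map f) (hF hfC)
  exact (h F y hF hy hFy).comp (tendsto_nhdsWithin_iff.2 ⟨hFy, hF hfU⟩)

/-- Explicit harmonic measure of the extremal set
`K_λ = [−1, −1+λ] ∪ [1−λ, 1]` with respect to the unit disk, computed at `0`:
`ω(0) = (2/π)·arcsin((1−(1−λ)²)/(1+(1−λ)²))`. -/
theorem harmonic_measure_extremal_set
    (lam : ℝ) (hlam0 : 0 < lam) (hlam1 : lam < 1)
    (ω : ℂ → ℝ)
    (hω : IsHarmonicMeasureFn ω (Metric.ball (0 : ℂ) 1)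
      (Complex.ofReal ''
        (Set.Icc (-1 : ℝ) (-1 + lam) ∪ Set.Icc (1 - lam) 1))) :
    ω 0 = 2 / Real.pi *
      Real.arcsin ((1 - (1 - lam) ^ 2) / (1 + (1 - lam) ^ 2)) := by
  set K : Set ℂ := Complex.ofReal ''
    (Set.Icc (-1 : ℝ) (-1 + lam) ∪ Set.Icc (1 - lam) 1) with hK
  set r : ℝ := 1 - lam with hr
  have hr0 : 0 < r := by linarith
  have hr1 : r < 1 := by linarith
  set c : ℝ := 2 * r / (1 + r ^ 2) with hc
  have hcr : c * (1 + r ^ 2) = 2 * r := div_mul_cancel₀ _ (by positivity)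
  have hc0 : 0 < c := by positivity
  have hc1 : c < 1 := by rw [hc, div_lt_one (by positivity)]; nlinarith
  have hmemK : ∀ z : ℂ, z ∈ K ↔ z.im = 0 ∧ r ≤ |z.re| ∧ |z.re| ≤ 1 := by
    intro z
    rw [hK]
    constructor
    · rintro ⟨x, hx, rfl⟩
      refine ⟨Complex.ofReal_im x, ?_⟩
      rw [Complex.ofReal_re]
      rcases hx with hx | hx
      · rw [abs_of_neg (by linarith [hx.2])]
        exact ⟨by linarith [hx.2], by linarith [hx.1]⟩
      · rw [abs_of_pos (by linarith [hx.1])]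
        exact hx
    · rintro ⟨h0, h1, h2⟩
      refine ⟨z.re, ?_, Complex.ext (by simp) (by simp [h0])⟩
      rw [abs_le] at h2
      rcases le_abs.1 h1 with h | h
      · exact Or.inr ⟨h, h2.2⟩
      · exact Or.inl ⟨h2.1, by linarith⟩
  have hKclosed : IsClosed K := by
    rw [hK]
    exact Complex.isometry_ofReal.isClosedEmbedding.isClosedMap _ (isClosed_Icc.union isClosed_Icc)
  obtain ⟨hharm, hbd, hone, hzero⟩ := hω
  have hUopen : IsOpen (ball (0 : ℂ) 1 \ K) := isOpen_ball.sdiff hKclosed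
  obtain ⟨φ, hφa, hφ⟩ := exists_analyticOnNhd_joukowski hc0 hc1
  have hmaps : MapsTo φ (ball 0 1) (ball (0 : ℂ) 1 \ K) := by
    intro ζ hζ
    obtain ⟨h1, h2⟩ := hφ ζ hζ
    refine ⟨mem_ball_zero_iff.2 h1, fun hmem => ?_⟩
    obtain ⟨him, hre, -⟩ := (hmemK _).1 hmem
    have hre1 := (Complex.abs_re_le_norm (φ ζ)).trans_lt h1
    have hz : φ ζ = ((φ ζ).re : ℂ) := Complex.ext (by simp) (by simp [him])
    generalize (φ ζ).re = x at *
    rw [hz] at h2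
    have hx0 : x ≠ 0 := abs_pos.1 (hr0.trans_le hre)
    have hn := norm_eq_one_of_quadratic (a := x) (b := c * (1 + x ^ 2)) (z := ζ) hx0 ?_ ?_
    · rw [mem_ball_zero_iff] at hζ
      linarith
    · rw [abs_of_pos (by positivity), ← sq_abs x]
      have : c * (1 + r ^ 2) * (1 + |x| ^ 2) ≤ 2 * |x| * (1 + r ^ 2) := by
        rw [hcr]
        nlinarith [mul_nonneg (sub_nonneg.2 hre) (by nlinarith : 0 ≤ 1 - r * |x|)]
      have hp : 0 < 1 + r ^ 2 := by positivity
      nlinarith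
    · push_cast
      linear_combination h2
  have hφ0 : φ 0 = 0 := by simpa using (hφ 0 (mem_ball_self one_pos)).2
  have hlim : ∀ᵐ θ : ℝ, Tendsto (fun ρ : ℝ => ω (φ (circleMap 0 ρ θ))) (𝓝[<] 1)
      (𝓝 (if c < |Real.cos θ| then 1 else 0)) := by
    filter_upwards [ae_abs_cos_ne c] with θ hθ
    have hev : ∀ᶠ ρ : ℝ in 𝓝[<] 1, circleMap 0 ρ θ ∈ ball (0 : ℂ) 1 := by
      filter_upwards [Ioo_mem_nhdsLT (zero_lt_one' ℝ)] with ρ h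
      rw [mem_ball_zero_iff, norm_circleMap_zero, abs_of_pos h.1]
      exact h.2
    refine tendsto_comp_of_forall_ultrafilter (f := fun ρ : ℝ => φ (circleMap 0 ρ θ))
      (isCompact_closedBall (0 : ℂ) 1) (U := ball (0 : ℂ) 1 \ K)
      (hev.mono fun ρ h => ball_subset_closedBall (hmaps h).1)
      (hev.mono fun ρ h => hmaps h) ?_
    intro F y hF hy hFy
    rw [mem_closedBall_zero_iff] at hy
    have hcm : Tendsto (fun ρ : ℝ => circleMap 0 ρ θ) F (𝓝 (exp (θ * I))) := by
      have : Continuous fun ρ : ℝ => circleMap 0 ρ θ := by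
        unfold circleMap
        fun_prop
      have h1 := this.tendsto 1
      simp only [circleMap, Complex.ofReal_one, one_mul, zero_add] at h1
      simp only [circleMap, zero_add]
      exact h1.mono_left (hF.trans nhdsWithin_le_nhds)
    have heq : y * (1 + exp (θ * I) ^ 2) = c * exp (θ * I) * (1 + y ^ 2) := by
      refine tendsto_nhds_unique (hFy.mul ((hcm.pow 2).const_add 1)) ?_
      refine Tendsto.congr' ?_ ((hcm.const_mul (c : ℂ)).mul ((hFy.pow 2).const_add 1))
      have : ∀ᶠ ρ in (F : Filter ℝ), circleMap 0 ρ θ ∈ ball (0 : ℂ) 1 := hF hev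
      filter_upwards [this] with ρ h using (hφ _ h).2.symm
    have hq : (c : ℂ) * (1 + y ^ 2) = ((2 * Real.cos θ : ℝ) : ℂ) * y := by
      have he := Complex.exp_ne_zero (θ * I)
      apply mul_left_cancel₀ he
      have hcos : ((2 * Real.cos θ : ℝ) : ℂ) * exp (θ * I) = 1 + exp (θ * I) ^ 2 := by
        push_cast
        rw [Complex.two_cos, add_mul, ← Complex.exp_add, ← Complex.exp_add, sq, ← Complex.exp_add]
        simp [add_comm]
      linear_combination -heq - y * hcos
    have habs : |2 * Real.cos θ| = 2 * |Real.cos θ| := by rw [abs_mul, abs_two]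
    split_ifs with hlt
    · obtain ⟨him, hre1, hre⟩ := im_eq_zero_of_quadratic hc0.ne'
        (by rw [habs, abs_of_pos hc0]; linarith) hy hq
      apply hone
      refine ⟨(hmemK y).2 ⟨him, ?_, hre1.le⟩, ?_⟩
      · rw [habs, abs_of_pos hc0] at hre
        have hle : c * (1 + |y.re| ^ 2) ≤ 2 * |y.re| := by
          rw [hre]
          nlinarith [Real.abs_cos_le_one θ, abs_nonneg y.re]
        by_contra! hcon
        have h5 : 2 * r * (1 + |y.re| ^ 2) ≤ 2 * |y.re| * (1 + r ^ 2) := by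
          rw [← hcr]
          nlinarith [sq_nonneg r]
        have h6 : 0 < 1 - r * |y.re| := by nlinarith [abs_nonneg y.re]
        nlinarith [mul_pos (sub_pos.2 hcon) h6]
      · rw [mem_ball_zero_iff, ← Complex.abs_re_eq_norm.2 him]
        exact hre1
    · have hlt' : |Real.cos θ| < c := lt_of_le_of_ne (not_lt.1 hlt) hθ
      have hn : ‖y‖ = 1 := norm_eq_one_of_quadratic hc0.ne'
        (by rw [habs, abs_of_pos hc0]; linarith) hq
      apply hzero
      rw [frontier_ball _ one_ne_zero]
      refine ⟨mem_sphere_zero_iff_norm.2 hn, fun hmem => ?_⟩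
      obtain ⟨him, -, -⟩ := (hmemK _).1 hmem
      have hre : |y.re| = 1 := by rw [Complex.abs_re_eq_norm.2 him, hn]
      have hz : y = (y.re : ℂ) := Complex.ext (by simp) (by simp [him])
      rw [hz] at hq
      have hq' : c * (1 + y.re ^ 2) = 2 * Real.cos θ * y.re := by exact_mod_cast hq
      have hab := congrArg abs hq'
      rw [abs_mul, abs_mul, habs, hre, ← sq_abs y.re, hre, abs_of_pos hc0] at hab
      norm_num at hab
      linarith
  have hmain := harmonic_apply_eq_of_radial_limits (hharm.harmonicOnNhd hUopen)
    (fun z hz => abs_le.2 ⟨by linarith [(hbd z hz).1], (hbd z hz).2⟩) hφa hmaps hlim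
  rw [hφ0, integral_indicator_lt_abs_cos hc0 hc1] at hmain
  have hsin : Real.arccos c = Real.arcsin ((1 - r ^ 2) / (1 + r ^ 2)) := by
    rw [Real.arccos_eq_arcsin hc0.le]
    congr 1
    rw [Real.sqrt_eq_iff_mul_self_eq (by nlinarith)
      (div_nonneg (by nlinarith) (by positivity)), hc]
    field_simp
    ring
  rw [hmain, hsin]
  have := Real.pi_pos
  field_simp
  ring
end
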